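/- arXiv:1601.07514 — 8 statements merged into one kernel-verified Lean document; each statement's English description precedes it below -/
import Mathlib

section
/- Let d, l, m be positive integers with d ≥ 2 and d dividing m, and let a_1, …, a_l be positive integers with a_1 + ⋯ + a_l = m. Assume that either (i) d is divisible by 2 or by 3, and l ≥ m/d + 3, or (ii) d is relatively prime to 6, and l ≥ m/d + 2. Then ∑_{i=1}^{l} (d − gcd(a_i, d)) > 2d (equivalently, 2d − ∑_{i=1}^{l} (d − gcd(a_i, d)) < 0). -/
theorem Nat.Coprime.five_mul_le_of_dvd {d g : ℕ} (hd : Nat.Coprime d 6) (hgd : g ∣ d)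
    (hne : g ≠ d) : 5 * g ≤ d := by
  obtain ⟨c, rfl⟩ := hgd
  have hc : Nat.Coprime c 6 := Nat.Coprime.coprime_mul_left hd
  have h5 : 5 ≤ c := by
    by_contra! hlt
    interval_cases c <;> first | exact absurd hc (by decide) | exact hne (mul_one g).symm
  nlinarith

/-- A sum of terms `d - g i`, with `g i` a positive divisor of `d` and `d` coprime to `6`,
cannot equal `2 * d`. -/
theorem sum_sub_dvd_ne_two_mul {ι : Type*} (s : Finset ι) {d : ℕ} (hd0 : 0 < d)
    (hd : Nat.Coprime d 6) (g : ι → ℕ) (hpos : ∀ i, 0 < g i) (hgd : ∀ i, g i ∣ d) :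
    ∑ i ∈ s, (d - g i) ≠ 2 * d := by
  intro heq
  set t := s.filter (fun i => d - g i ≠ 0) with ht
  have hsum : ∑ i ∈ t, (d - g i) = 2 * d := by rw [ht, Finset.sum_filter_ne_zero, heq]
  have hlower : t.card * (4 * d) ≤ 5 * (2 * d) := by
    rw [← hsum, Finset.mul_sum, ← smul_eq_mul]
    refine Finset.card_nsmul_le_sum _ _ _ fun i hi => ?_
    have hne := (Finset.mem_filter.mp hi).2
    have := hd.five_mul_le_of_dvd (hgd i) (by omega)
    omega
  have hcard : t.card ≤ 2 := by
    by_contra! h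
    nlinarith
  have htne : t.Nonempty := by
    rw [Finset.nonempty_iff_ne_empty]
    intro h
    rw [h, Finset.sum_empty] at hsum
    omega
  have hupper : ∑ i ∈ t, (d - g i) < t.card * d := by
    rw [← smul_eq_mul, ← Finset.sum_const]
    exact Finset.sum_lt_sum_of_nonempty htne fun i _ => Nat.sub_lt hd0 (hpos i)
  nlinarith

/-- Arithmetic content of the lemma on hyperbolicity of cyclic covers of ℙ¹:
if `d ≥ 2` divides `m`, `a₁ + ⋯ + a_l = m` with all `aᵢ > 0`, and either
`2 ∣ d` or `3 ∣ d` together with `l ≥ m/d + 3`, or `gcd(d,6) = 1` together with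
`l ≥ m/d + 2`, then `∑ (d - gcd(aᵢ, d)) > 2d`. -/
theorem cyclic_cover_P1_hyperbolic_numerics
    (d l m : ℕ) (hd : 2 ≤ d) (hl : 0 < l) (hm : 0 < m) (hdm : d ∣ m)
    (a : Fin l → ℕ) (ha : ∀ i, 0 < a i) (hsum : ∑ i, a i = m)
    (hcase : ((2 ∣ d ∨ 3 ∣ d) ∧ m / d + 3 ≤ l) ∨ (Nat.Coprime d 6 ∧ m / d + 2 ≤ l)) :
    2 * d < ∑ i, (d - Nat.gcd (a i) d) := by
  have hd0 : 0 < d := by omega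
  obtain ⟨k, rfl⟩ := hdm
  rw [Nat.mul_div_cancel_left k hd0] at hcase
  have hle : l * d ≤ ∑ i, (d - Nat.gcd (a i) d) + d * k := by
    rw [← hsum, ← Finset.sum_add_distrib]
    calc l * d = ∑ _i : Fin l, d := by simp
      _ ≤ _ := Finset.sum_le_sum fun i _ => by
        have := Nat.gcd_le_left d (ha i)
        omega
  rcases hcase with ⟨-, h⟩ | ⟨hcop, h⟩
  · nlinarith
  · refine lt_of_le_of_ne (by nlinarith) (Ne.symm ?_)
    exact sum_sub_dvd_ne_two_mul _ hd0 hcop _ (fun i => Nat.gcd_pos_of_pos_right _ hd0)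
      fun i => Nat.gcd_dvd_right _ _
end

section
/- Let d, l, m be positive integers with d ≥ 2 and d dividing m, and let a_1, …, a_l be positive integers with a_1 + ⋯ + a_l = m. Assume that either (i) d is even and l ≥ m/d + 2, or (ii) d is odd and l ≥ m/d + 1. Then ∑_{i=1}^{l} (d − gcd(a_i, d)) > d (equivalently, d − ∑_{i=1}^{l} (d − gcd(a_i, d)) < 0). -/
/-- A proper divisor of `d` of the form `gcd a d` is at most `d / 2`. -/
theorem le_two_mul_sub_gcd {a d : ℕ} (hd : 0 < d) (h : ¬ d ∣ a) :
    d ≤ 2 * (d - Nat.gcd a d) := by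
  obtain ⟨q, hq⟩ := Nat.gcd_dvd_right a d
  have hq0 : q ≠ 0 := by rintro rfl; omega
  have hq1 : q ≠ 1 := by
    rintro rfl
    exact h (Nat.gcd_eq_right_iff_dvd.mp (by omega))
  have : Nat.gcd a d * 2 ≤ Nat.gcd a d * q := Nat.mul_le_mul_left _ (by omega)
  omega

/-- A proper divisor of an odd `d` of the form `gcd a d` is at most `d / 3`. -/
theorem two_mul_le_three_mul_sub_gcd {a d : ℕ} (hd : Odd d) (h : ¬ d ∣ a) :
    2 * d ≤ 3 * (d - Nat.gcd a d) := by
  obtain ⟨q, hq⟩ := Nat.gcd_dvd_right a d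
  have hq_odd : Odd q := hd.of_dvd_nat ⟨Nat.gcd a d, by rw [mul_comm]; exact hq⟩
  have hq1 : q ≠ 1 := by
    rintro rfl
    exact h (Nat.gcd_eq_right_iff_dvd.mp (by omega))
  have : Nat.gcd a d * 3 ≤ Nat.gcd a d * q :=
    Nat.mul_le_mul_left _ (by obtain ⟨r, rfl⟩ := hq_odd; omega)
  omega

/-- Arithmetic content of the lemma on hyperbolicity of cyclic covers of 𝔸¹:
if `d ≥ 2` divides `m`, `a₁ + ⋯ + a_l = m` with all `aᵢ > 0`, and either
`d` is even together with `l ≥ m/d + 2`, or `d` is odd together with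
`l ≥ m/d + 1`, then `∑ (d - gcd(aᵢ, d)) > d`. -/
theorem cyclic_cover_A1_hyperbolic_numerics
    (d l m : ℕ) (hd : 2 ≤ d) (hl : 0 < l) (hm : 0 < m) (hdm : d ∣ m)
    (a : Fin l → ℕ) (ha : ∀ i, 0 < a i) (hsum : ∑ i, a i = m)
    (hcase : (Even d ∧ m / d + 2 ≤ l) ∨ (Odd d ∧ m / d + 1 ≤ l)) :
    d < ∑ i, (d - Nat.gcd (a i) d) := by
  obtain ⟨k, rfl⟩ := hdm
  rw [Nat.mul_div_cancel_left k (by omega)] at hcase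
  set S := Finset.univ.filter fun i => ¬ d ∣ a i
  set T := Finset.univ.filter fun i => d ∣ a i
  have hcard : T.card + S.card = l := by
    simpa using Finset.card_filter_add_card_filter_not (s := Finset.univ) fun i => d ∣ a i
  have hTS : ∑ i ∈ T, a i + ∑ i ∈ S, a i = d * k :=
    (Finset.sum_filter_add_sum_filter_not _ _ _).trans hsum
  have hTsum : T.card * d ≤ ∑ i ∈ T, a i :=
    Finset.card_nsmul_le_sum _ _ _ fun i hi =>
      Nat.le_of_dvd (ha i) (Finset.mem_filter.mp hi).2
  have hSsum : S.card ≤ ∑ i ∈ S, a i := by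
    simpa using Finset.card_nsmul_le_sum S a 1 fun i _ => ha i
  have hTk : T.card ≤ k :=
    Nat.le_of_mul_le_mul_left (by rw [mul_comm]; omega : d * T.card ≤ d * k) (by omega)
  have hSpos : 0 < S.card := by omega
  have hTk' : T.card < k :=
    Nat.lt_of_mul_lt_mul_left (a := d) (by rw [mul_comm]; omega)
  have hle : ∑ i ∈ S, (d - Nat.gcd (a i) d) ≤ ∑ i, (d - Nat.gcd (a i) d) :=
    Finset.sum_le_sum_of_subset (Finset.subset_univ _)
  rcases hcase with ⟨-, hkl⟩ | ⟨hodd, hkl⟩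
  · have hbound : S.card * d ≤ ∑ i ∈ S, 2 * (d - Nat.gcd (a i) d) :=
      Finset.card_nsmul_le_sum _ _ _ fun i hi =>
        le_two_mul_sub_gcd (by omega) (Finset.mem_filter.mp hi).2
    rw [← Finset.mul_sum] at hbound
    have : 3 * d ≤ S.card * d := Nat.mul_le_mul_right _ (by omega)
    omega
  · have hbound : S.card * (2 * d) ≤ ∑ i ∈ S, 3 * (d - Nat.gcd (a i) d) :=
      Finset.card_nsmul_le_sum _ _ _ fun i hi =>
        two_mul_le_three_mul_sub_gcd hodd (Finset.mem_filter.mp hi).2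
    rw [← Finset.mul_sum] at hbound
    have : 2 * (2 * d) ≤ S.card * (2 * d) := Nat.mul_le_mul_right _ (by omega)
    omega
end

section
/- Let d, l, m be positive integers with d ≥ 2 and d dividing m, and let a_1, …, a_l be positive integers with a_1 + ⋯ + a_l = m. If ∑_{i=1}^{l} (d − gcd(a_i, d)) ≤ 2d, then the multiset R of residues a_i mod d over all indices i with d not dividing a_i is one of the following: (0) the empty multiset; (1) {r, d−r} for some integer 0 < r < d; (2) {d/2, d/3, d/6} with 6 dividing d; (3) {d/2, 2d/3, 5d/6} with 6 dividing d; (4) {d/2, d/4, d/4} with 4 dividing d; (5) {d/2, 3d/4, 3d/4} with 4 dividing d; (6) {d/3, d/3, d/3} with 3 dividing d; (7) {2d/3, 2d/3, 2d/3} with 3 dividing d; (8) {d/2, d/2, d/2, d/2} with 2 dividing d. -/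
/-- A positive residue `x` modulo `d` has order `d / gcd x d` in `ℤ/d`, which is `2`, `3`, `4`
or at least `5`. -/
theorem Nat.gcd_residue_cases {d x : ℕ} (hx : 0 < x) (hxd : x < d) :
    (2 * x.gcd d = d ∧ x = x.gcd d) ∨
    (3 * x.gcd d = d ∧ (x = x.gcd d ∨ x = 2 * x.gcd d)) ∨
    (4 * x.gcd d = d ∧ (x = x.gcd d ∨ x = 3 * x.gcd d)) ∨
    5 * x.gcd d ≤ d := by
  have hg : 0 < x.gcd d := Nat.gcd_pos_of_pos_left _ hx
  obtain ⟨k, hk⟩ := Nat.gcd_dvd_left x d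
  obtain ⟨n, hn⟩ := Nat.gcd_dvd_right x d
  have hcop : k.gcd n = 1 := by
    have h := Nat.gcd_mul_left (x.gcd d) k n
    rw [← hk, ← hn] at h
    exact Nat.eq_of_mul_eq_mul_left hg (by rw [← h, mul_one])
  generalize x.gcd d = g at *
  subst hk hn
  have hkn : k < n := Nat.lt_of_mul_lt_mul_left hxd
  have hk : 0 < k := Nat.pos_of_mul_pos_left hx
  by_cases h5 : 5 ≤ n
  · right; right; right
    nlinarith
  · have hn : n < 5 := by omega
    interval_cases n <;> interval_cases k <;> simp_all <;> omega

/-- Triples of nonzero residues with sum `0` modulo `d` and gcd sum at least `d`, listed by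
decreasing gcd. -/
theorem Nat.residue_triple_cases {d x y z : ℕ} (hx : 0 < x) (hxd : x < d)
    (hy : 0 < y) (hyd : y < d) (hz : 0 < z) (hzd : z < d) (hdvd : d ∣ x + y + z)
    (hle : d ≤ x.gcd d + y.gcd d + z.gcd d) (hxy : y.gcd d ≤ x.gcd d)
    (hyz : z.gcd d ≤ y.gcd d) :
    (6 ∣ d ∧ x = d / 2 ∧ y = d / 3 ∧ z = d / 6) ∨
    (6 ∣ d ∧ x = d / 2 ∧ y = 2 * d / 3 ∧ z = 5 * d / 6) ∨
    (4 ∣ d ∧ x = d / 2 ∧ y = d / 4 ∧ z = d / 4) ∨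
    (4 ∣ d ∧ x = d / 2 ∧ y = 3 * d / 4 ∧ z = 3 * d / 4) ∨
    (3 ∣ d ∧ x = d / 3 ∧ y = d / 3 ∧ z = d / 3) ∨
    (3 ∣ d ∧ x = 2 * d / 3 ∧ y = 2 * d / 3 ∧ z = 2 * d / 3) := by
  obtain ⟨c, hc⟩ := hdvd
  have hc3 : c < 3 := by nlinarith
  have hsum : x + y + z = d ∨ x + y + z = 2 * d := by
    interval_cases c <;> omega
  have hgx := Nat.gcd_residue_cases hx hxd
  have hgy := Nat.gcd_residue_cases hy hyd
  have hgz := Nat.gcd_residue_cases hz hzd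
  clear hc hc3
  generalize x.gcd d = g at *
  generalize y.gcd d = h at *
  generalize z.gcd d = k at *
  rcases hgx with ⟨hg, rfl⟩ | ⟨hg, hgx⟩ | ⟨hg, -⟩ | hg
  · rcases hgy with ⟨hh, rfl⟩ | ⟨hh, rfl | rfl⟩ | ⟨hh, hgy⟩ | hh
    · clear hgz
      exfalso
      omega
    · have hz : 6 * z = d := by
        clear hgz
        omega
      clear hgz hsum
      exact Or.inl (by omega)
    · have hz : 6 * z = 5 * d := by
        clear hgz
        omega
      clear hgz hsum
      exact Or.inr (Or.inl (by omega))
    · obtain rfl : k = h := by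
        clear hgy hgz hsum
        omega
      have hz : z = k ∨ z = 3 * k := by
        clear hgy hsum
        omega
      clear hgz
      rcases hgy with rfl | rfl <;> rcases hz with rfl | rfl
      · exact Or.inr (Or.inr (Or.inl (by omega)))
      · exfalso
        omega
      · exfalso
        omega
      · exact Or.inr (Or.inr (Or.inr (Or.inl (by omega))))
    · clear hgz hsum
      exfalso
      omega
  · obtain ⟨rfl, rfl⟩ : h = g ∧ k = g := by
      clear hgx hgy hgz hsum
      omega
    have hy : y = k ∨ y = 2 * k := by
      clear hgx hgz hsum
      omega
    have hz : z = k ∨ z = 2 * k := by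
      clear hgx hgy hsum
      omega
    clear hgy hgz
    have hxyz : x = k ∧ y = k ∧ z = k ∨ x = 2 * k ∧ y = 2 * k ∧ z = 2 * k := by omega
    clear hgx hy hz hsum
    rcases hxyz with h | h
    · exact Or.inr (Or.inr (Or.inr (Or.inr (Or.inl (by omega)))))
    · exact Or.inr (Or.inr (Or.inr (Or.inr (Or.inr (by omega)))))
  · clear hgy hgz hsum
    exfalso
    omega
  · clear hgy hgz hsum
    exfalso
    omega

/-- The multisets of nonzero residues modulo `d` with sum `0` and total ramification at most
`2 * d`. -/
theorem Multiset.residue_classification {d : ℕ} {R : Multiset ℕ}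
    (hR : ∀ x ∈ R, 0 < x ∧ x < d) (hdvd : d ∣ R.sum)
    (hle : (R.map fun x => d - x.gcd d).sum ≤ 2 * d) :
    R = 0 ∨
    (∃ r : ℕ, 0 < r ∧ r < d ∧ R = {r, d - r}) ∨
    (6 ∣ d ∧ R = {d / 2, d / 3, d / 6}) ∨
    (6 ∣ d ∧ R = {d / 2, 2 * d / 3, 5 * d / 6}) ∨
    (4 ∣ d ∧ R = {d / 2, d / 4, d / 4}) ∨
    (4 ∣ d ∧ R = {d / 2, 3 * d / 4, 3 * d / 4}) ∨
    (3 ∣ d ∧ R = {d / 3, d / 3, d / 3}) ∨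
    (3 ∣ d ∧ R = {2 * d / 3, 2 * d / 3, 2 * d / 3}) ∨
    (2 ∣ d ∧ R = {d / 2, d / 2, d / 2, d / 2}) := by
  have half : ∀ x ∈ R, 2 * x.gcd d ≤ d := fun x hx => by
    have := Nat.gcd_residue_cases (hR x hx).1 (hR x hx).2
    omega
  have hcard : R.card < 5 := by
    by_contra! h
    obtain ⟨x, hx⟩ := Multiset.card_pos_iff_exists_mem.1 (by omega : 0 < R.card)
    have hd := hR x hx
    have hlow := Multiset.card_nsmul_le_sum
      (s := R.map fun x => 2 * (d - x.gcd d)) (a := d) (by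
        simp only [Multiset.mem_map, forall_exists_index, and_imp]
        rintro _ y hy rfl
        have := half y hy
        omega)
    rw [Multiset.sum_map_mul_left, Multiset.card_map, smul_eq_mul] at hlow
    nlinarith
  obtain h | h | h | h | h :
      R.card = 0 ∨ R.card = 1 ∨ R.card = 2 ∨ R.card = 3 ∨ R.card = 4 := by omega
  · exact Or.inl (Multiset.card_eq_zero.1 h)
  · obtain ⟨x, rfl⟩ := Multiset.card_eq_one.1 h
    have hx := hR x (by simp)
    rw [Multiset.sum_singleton] at hdvd
    exact absurd (Nat.le_of_dvd hx.1 hdvd) (by omega)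
  · obtain ⟨x, y, rfl⟩ := Multiset.card_eq_two.1 h
    have hx := hR x (by simp)
    have hy := hR y (by simp)
    obtain ⟨c, hc⟩ := hdvd
    simp only [Multiset.insert_eq_cons, Multiset.sum_cons, Multiset.sum_singleton] at hc
    have hc2 : c < 2 := by nlinarith
    have hxy : y = d - x := by interval_cases c <;> omega
    exact Or.inr (Or.inl ⟨x, hx.1, hx.2, by rw [hxy]⟩)
  · right; right
    obtain ⟨x, y, z, rfl, hxy, hyz⟩ :
        ∃ x y z, R = {x, y, z} ∧ y.gcd d ≤ x.gcd d ∧ z.gcd d ≤ y.gcd d := by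
      obtain ⟨x, y, z, rfl⟩ := Multiset.card_eq_three.1 h
      have hyx : ({x, y, z} : Multiset ℕ) = {y, x, z} := Multiset.cons_swap x y {z}
      have hzy (u v w : ℕ) : ({u, v, w} : Multiset ℕ) = {u, w, v} := by
        rw [Multiset.insert_eq_cons, Multiset.pair_comm, ← Multiset.insert_eq_cons]
      have hzx : ({x, z, y} : Multiset ℕ) = {z, x, y} := Multiset.cons_swap x z {y}
      rcases le_total (x.gcd d) (y.gcd d) with h₁ | h₁ <;>
        rcases le_total (y.gcd d) (z.gcd d) with h₂ | h₂ <;>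
        rcases le_total (x.gcd d) (z.gcd d) with h₃ | h₃
      · exact ⟨z, y, x, by rw [hzy, hzx, hzy], h₂, h₁⟩
      · exact ⟨z, y, x, by rw [hzy, hzx, hzy], h₂, h₁⟩
      · exact ⟨y, z, x, by rw [hyx, hzy], h₂, h₃⟩
      · exact ⟨y, x, z, hyx, h₁, h₃⟩
      · exact ⟨z, x, y, by rw [hzy, hzx], h₃, h₁⟩
      · exact ⟨x, z, y, hzy x y z, h₃, h₂⟩
      · exact ⟨x, y, z, rfl, h₁, h₂⟩
      · exact ⟨x, y, z, rfl, h₁, h₂⟩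
    have hx := hR x (by simp)
    have hy := hR y (by simp)
    have hz := hR z (by simp)
    simp only [Multiset.insert_eq_cons, Multiset.sum_cons, Multiset.sum_singleton,
      Multiset.map_cons, Multiset.map_singleton, ← add_assoc] at hdvd hle
    have hgx := half x (by simp)
    have hgy := half y (by simp)
    have hgz := half z (by simp)
    rcases Nat.residue_triple_cases hx.1 hx.2 hy.1 hy.2 hz.1 hz.2 hdvd (by omega) hxy hyz with
      ⟨h, hx, hy, hz⟩ | ⟨h, hx, hy, hz⟩ | ⟨h, hx, hy, hz⟩ | ⟨h, hx, hy, hz⟩ |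
      ⟨h, hx, hy, hz⟩ | ⟨h, hx, hy, hz⟩ <;> rw [hx, hy, hz] <;> simp [h]
  · iterate 8 right
    have heq : ∀ x ∈ R, 2 ∣ d ∧ x = d / 2 := by
      intro x hx
      obtain ⟨S, rfl⟩ := Multiset.exists_cons_of_mem hx
      rw [Multiset.card_cons] at h
      obtain ⟨y, z, w, rfl⟩ := Multiset.card_eq_three.1 (Nat.succ.inj h)
      have hgx := half x (by simp)
      have hgy := half y (by simp)
      have hgz := half z (by simp)
      have hgw := half w (by simp)
      simp only [Multiset.insert_eq_cons, Multiset.sum_cons, Multiset.sum_singleton,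
        Multiset.map_cons, Multiset.map_singleton] at hle
      have := hR x hx
      have := Nat.gcd_residue_cases this.1 this.2
      omega
    obtain ⟨x, hx⟩ := Multiset.card_pos_iff_exists_mem.1 (by omega : 0 < R.card)
    exact ⟨(heq x hx).1, Multiset.eq_replicate.2 ⟨h, fun y hy => (heq y hy).2⟩⟩


/-- Arithmetic classification behind Table 1 (cyclic covers of ℙ¹ that are not
Brody hyperbolic): if `d ≥ 2` divides `m`, `a₁ + ⋯ + a_l = m` with all `aᵢ > 0`
and `∑ (d - gcd(aᵢ, d)) ≤ 2d`, then the multiset of residues `aᵢ mod d` over the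
indices with `d ∤ aᵢ` is one of the listed possibilities. -/
theorem cyclic_cover_P1_table
    (d l m : ℕ) (hd : 2 ≤ d) (hl : 0 < l) (hm : 0 < m) (hdm : d ∣ m)
    (a : Fin l → ℕ) (ha : ∀ i, 0 < a i) (hsum : ∑ i, a i = m)
    (hle : ∑ i, (d - Nat.gcd (a i) d) ≤ 2 * d)
    (R : Multiset ℕ)
    (hR : R = Multiset.map (fun i => a i % d) (Finset.univ.filter fun i => ¬ d ∣ a i).val) :
    R = 0 ∨
    (∃ r : ℕ, 0 < r ∧ r < d ∧ R = {r, d - r}) ∨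
    (6 ∣ d ∧ R = {d / 2, d / 3, d / 6}) ∨
    (6 ∣ d ∧ R = {d / 2, 2 * d / 3, 5 * d / 6}) ∨
    (4 ∣ d ∧ R = {d / 2, d / 4, d / 4}) ∨
    (4 ∣ d ∧ R = {d / 2, 3 * d / 4, 3 * d / 4}) ∨
    (3 ∣ d ∧ R = {d / 3, d / 3, d / 3}) ∨
    (3 ∣ d ∧ R = {2 * d / 3, 2 * d / 3, 2 * d / 3}) ∨
    (2 ∣ d ∧ R = {d / 2, d / 2, d / 2, d / 2}) := by
  have hdpos : 0 < d := by omega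
  subst hR
  apply Multiset.residue_classification
  · simp only [Multiset.mem_map, Finset.mem_val, Finset.mem_filter, Finset.mem_univ, true_and]
    rintro _ ⟨i, hi, rfl⟩
    exact ⟨Nat.pos_of_ne_zero fun h => hi (Nat.dvd_of_mod_eq_zero h), Nat.mod_lt _ hdpos⟩
  · change d ∣ ∑ i with ¬ d ∣ a i, a i % d
    rw [Finset.sum_filter_of_ne (p := fun i => ¬ d ∣ a i)
        fun i _ h hi => h (Nat.mod_eq_zero_of_dvd hi),
      Nat.dvd_iff_mod_eq_zero, ← Finset.sum_nat_mod, hsum]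
    exact Nat.mod_eq_zero_of_dvd hdm
  · rw [Multiset.map_map]
    change ∑ i with ¬ d ∣ a i, (d - (a i % d).gcd d) ≤ 2 * d
    refine le_trans ?_ hle
    simp only [← Nat.gcd_rec, Nat.gcd_comm (a _) d]
    exact Finset.sum_le_sum_of_subset (Finset.filter_subset _ _)
end

section
/- Let d, l, m be positive integers with d ≥ 2 and d dividing m, and let a_1, …, a_l be positive integers with a_1 + ⋯ + a_l = m. If ∑_{i=1}^{l} (d − gcd(a_i, d)) ≤ d, then either d divides a_i for every i, or d is even and there are exactly two indices i with d not dividing a_i, and for both of these indices a_i ≡ d/2 (mod d). -/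
theorem Nat.two_mul_gcd_le_of_not_dvd {a d : ℕ} (hd : 0 < d) (h : ¬ d ∣ a) :
    2 * Nat.gcd a d ≤ d := by
  obtain ⟨k, hk⟩ := Nat.gcd_dvd_right a d
  have hk0 : k ≠ 0 := by
    rintro rfl
    omega
  have hk1 : k ≠ 1 := by
    rintro rfl
    rw [mul_one] at hk
    exact h (hk ▸ Nat.gcd_dvd_left a d)
  calc 2 * Nat.gcd a d = Nat.gcd a d * 2 := mul_comm _ _
    _ ≤ Nat.gcd a d * k := Nat.mul_le_mul_left _ (by omega)
    _ = d := hk.symm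

theorem Nat.mod_eq_of_not_dvd_of_two_mul {a d g : ℕ} (hg : g ∣ a) (hd : d = 2 * g)
    (h : ¬ d ∣ a) : a % d = g := by
  obtain ⟨c, rfl⟩ := hg
  subst hd
  rw [mul_comm 2 g, Nat.mul_mod_mul_left]
  rcases Nat.mod_two_eq_zero_or_one c with hc | hc
  · exact absurd (mul_comm 2 g ▸ Nat.mul_dvd_mul_left g (Nat.dvd_of_mod_eq_zero hc)) h
  · rw [hc, mul_one]

theorem Finset.one_lt_card_filter_not_dvd {ι : Type*} {s : Finset ι} {a : ι → ℕ} {d : ℕ}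
    (hsum : d ∣ ∑ i ∈ s, a i) {i : ι} (his : i ∈ s) (hi : ¬ d ∣ a i) :
    1 < (s.filter fun i => ¬ d ∣ a i).card := by
  classical
  by_contra! hcard
  refine hi ?_
  rw [← Finset.add_sum_erase s a his] at hsum
  refine (Nat.dvd_add_left (Finset.dvd_sum fun j hj => ?_)).1 hsum
  by_contra hj'
  exact Finset.ne_of_mem_erase hj (Finset.card_le_one.1 hcard j
    (Finset.mem_filter.2 ⟨Finset.mem_of_mem_erase hj, hj'⟩) i
    (Finset.mem_filter.2 ⟨his, hi⟩))


/-- Arithmetic classification behind Table 2 (cyclic covers of 𝔸¹ that are not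
Brody hyperbolic): if `d ≥ 2` divides `m`, `a₁ + ⋯ + a_l = m` with all `aᵢ > 0`
and `∑ (d - gcd(aᵢ, d)) ≤ d`, then either `d` divides every `aᵢ`, or `d` is even,
there are exactly two indices `i` with `d ∤ aᵢ`, and each such index satisfies
`aᵢ ≡ d/2 (mod d)`. -/
theorem cyclic_cover_A1_table
    (d l m : ℕ) (hd : 2 ≤ d) (hl : 0 < l) (hm : 0 < m) (hdm : d ∣ m)
    (a : Fin l → ℕ) (ha : ∀ i, 0 < a i) (hsum : ∑ i, a i = m)
    (hle : ∑ i, (d - Nat.gcd (a i) d) ≤ d) :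
    (∀ i, d ∣ a i) ∨
    (Even d ∧ (Finset.univ.filter fun i => ¬ d ∣ a i).card = 2 ∧
      ∀ i, ¬ d ∣ a i → a i % d = d / 2) := by
  by_cases hall : ∀ i, d ∣ a i
  · exact Or.inl hall
  right
  push Not at hall
  obtain ⟨i₀, hi₀⟩ := hall
  have hcard := Finset.one_lt_card_filter_not_dvd (hsum ▸ hdm) (Finset.mem_univ i₀) hi₀
  set S := Finset.univ.filter fun i => ¬ d ∣ a i with hS
  have hterm : ∀ i ∈ S, d ≤ 2 * (d - Nat.gcd (a i) d) := fun i hi => by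
    have := Nat.two_mul_gcd_le_of_not_dvd (by omega) (Finset.mem_filter.1 hi).2
    omega
  have hupper : ∑ i ∈ S, 2 * (d - Nat.gcd (a i) d) ≤ 2 * d := by
    rw [← Finset.mul_sum]
    exact Nat.mul_le_mul_left 2
      ((Finset.sum_le_sum_of_subset (Finset.subset_univ S)).trans hle)
  have hlower : S.card * d ≤ ∑ i ∈ S, 2 * (d - Nat.gcd (a i) d) := by
    simpa using Finset.sum_le_sum hterm
  have hcard2 : S.card = 2 :=
    le_antisymm (Nat.le_of_mul_le_mul_right (hlower.trans hupper) (by omega)) hcard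
  have hgcd : ∀ i, ¬ d ∣ a i → d = 2 * Nat.gcd (a i) d := fun i hi => by
    have heq : ∑ _j ∈ S, d = ∑ j ∈ S, 2 * (d - Nat.gcd (a j) d) := by
      refine le_antisymm (Finset.sum_le_sum hterm) ?_
      simpa [hcard2] using hupper
    have := (Finset.sum_eq_sum_iff_of_le hterm).1 heq i (by simp [hS, hi])
    omega
  refine ⟨even_iff_two_dvd.2 ⟨_, hgcd i₀ hi₀⟩, hcard2, fun i hi => ?_⟩
  have h := hgcd i hi
  rw [Nat.mod_eq_of_not_dvd_of_two_mul (Nat.gcd_dvd_left (a i) d) h hi]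
  omega
end

section
/- Let d, l, m be positive integers with d ≥ 2 and d dividing m, let p_1, …, p_l be distinct complex numbers, and let a_1, …, a_l be positive integers with a_1 + ⋯ + a_l = m. Assume that either (i) d is divisible by 2 or by 3, and l ≥ m/d + 3, or (ii) d is relatively prime to 6, and l ≥ m/d + 2. Then for all entire functions g_0, g_1, h : ℂ → ℂ such that g_0 and g_1 have no common zero and h(z)^d = ∏_{i=1}^{l} (g_0(z) − p_i g_1(z))^{a_i} for all z ∈ ℂ, the functions g_0 and g_1 are linearly dependent over ℂ (i.e. there exist constants c_0, c_1 ∈ ℂ, not both zero, with c_1 g_0 = c_0 g_1 identically). -/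
open Filter Topology

/-- A first-order form of the Ahlfors lemma. -/
theorem mul_norm_deriv_sq_le_of_isLocalMax {H b m : ℂ → ℂ} {b' m' z₀ : ℂ} {γ : ℝ} (hγ : 0 < γ)
    (hH : ∀ᶠ z in 𝓝 z₀, DifferentiableAt ℂ H z) (hH0 : H z₀ ≠ 0)
    (hb : HasDerivAt b b' z₀) (hb0 : b z₀ = 0) (hm : HasDerivAt m m' z₀) (hm0 : m z₀ = 0)
    (hle : ∀ᶠ z in 𝓝 z₀, ‖H z‖ * (1 + ‖b z‖ ^ 2) ^ γ * (1 - ‖m z‖ ^ 2) ≤ ‖H z₀‖) :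
    γ * ‖b'‖ ^ 2 ≤ ‖m'‖ ^ 2 := by
  by_contra! hlt
  have hslope : ∀ {f : ℂ → ℂ} {f' : ℂ}, HasDerivAt f f' z₀ → f z₀ = 0 →
      Tendsto (fun z => ‖f z‖ ^ 2 / ‖z - z₀‖ ^ 2) (𝓝[≠] z₀) (𝓝 (‖f'‖ ^ 2)) := by
    intro f f' hf hf0
    refine ((hasDerivAt_iff_tendsto_slope.1 hf).norm.pow 2).congr fun z => ?_
    rw [slope_def_field, hf0, sub_zero, norm_div, div_pow]
  have hsq : ∀ {f : ℂ → ℂ} {f' : ℂ}, HasDerivAt f f' z₀ → f z₀ = 0 →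
      Tendsto (fun z => ‖f z‖ ^ 2) (𝓝[≠] z₀) (𝓝 0) := by
    intro f f' hf hf0
    have : Tendsto (fun z => ‖f z‖ ^ 2) (𝓝[≠] z₀) (𝓝 (‖f z₀‖ ^ 2)) :=
      (hf.continuousAt.tendsto.mono_left nhdsWithin_le_nhds).norm.pow 2
    simpa [hf0] using this
  have hlim : ∀ᶠ z in 𝓝[≠] z₀,
      ‖m z‖ ^ 2 / ‖z - z₀‖ ^ 2 * (1 + ‖b z‖ ^ 2) <
        γ * (‖b z‖ ^ 2 / ‖z - z₀‖ ^ 2) * (1 - ‖m z‖ ^ 2) := by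
    refine Tendsto.eventually_lt ((hslope hm hm0).mul ((hsq hb hb0).const_add 1))
      (((hslope hb hb0).const_mul γ).mul ((hsq hm hm0).const_sub 1)) ?_
    simpa using hlt
  have hm1 : ∀ᶠ z in 𝓝[≠] z₀, ‖m z‖ ^ 2 < 1 := (hsq hm hm0).eventually_lt_const one_pos
  have hHne : ∀ᶠ z in 𝓝[≠] z₀, H z ≠ 0 :=
    (hH.self_of_nhds.continuousAt.eventually_ne hH0).filter_mono nhdsWithin_le_nhds
  have hstrict : ∀ᶠ z in 𝓝[≠] z₀, ‖H z‖ < ‖H z₀‖ := by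
    filter_upwards [hlim, hm1, hHne, hle.filter_mono nhdsWithin_le_nhds, self_mem_nhdsWithin]
      with z h1 h2 h3 h4 h5
    have hz : 0 < ‖z - z₀‖ ^ 2 := by
      have : 0 < ‖z - z₀‖ := norm_pos_iff.2 (sub_ne_zero.2 h5)
      positivity
    have hz' := hz.ne'
    set x := ‖b z‖ ^ 2 with hx
    set y := ‖m z‖ ^ 2 with hy
    have hx0 : 0 ≤ x := by positivity
    set t := ‖z - z₀‖ ^ 2
    have hxy : y * (1 + x) < γ * x * (1 - y) := by
      have := mul_lt_mul_of_pos_right h1 hz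
      have e1 : y / t * (1 + x) * t = y * (1 + x) := by field_simp
      have e2 : γ * (x / t) * (1 - y) * t = γ * x * (1 - y) := by
        field_simp
      rwa [e1, e2] at this
    have hy1 : 0 < 1 - y := by linarith
    have hlog : 0 < Real.log ((1 + x) ^ γ * (1 - y)) := by
      rw [Real.log_mul (by positivity) hy1.ne', Real.log_rpow (by positivity)]
      have l1 := Real.one_sub_inv_le_log_of_pos (show 0 < 1 + x by positivity)
      have l2 := Real.one_sub_inv_le_log_of_pos hy1
      have l3 : 0 < γ * (1 - (1 + x)⁻¹) + (1 - (1 - y)⁻¹) := by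
        have : γ * (1 - (1 + x)⁻¹) + (1 - (1 - y)⁻¹) =
            (γ * x * (1 - y) - y * (1 + x)) / ((1 + x) * (1 - y)) := by
          field_simp
          ring
        rw [this]
        exact div_pos (by linarith) (by positivity)
      nlinarith [mul_le_mul_of_nonneg_left l1 hγ.le]
    have h1lt : 1 < (1 + x) ^ γ * (1 - y) := (Real.log_pos_iff (by positivity)).1 hlog
    calc ‖H z‖ < ‖H z‖ * ((1 + x) ^ γ * (1 - y)) :=
          lt_mul_of_one_lt_right (norm_pos_iff.2 h3) h1lt
      _ ≤ ‖H z₀‖ := by rw [← mul_assoc]; exact h4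
  have hmax : IsLocalMax (norm ∘ H) z₀ := by
    have := eventually_nhdsWithin_iff.1 hstrict
    filter_upwards [this] with z hz
    by_cases h : z = z₀
    · simp [h]
    · exact (hz h).le
  have hconst := Complex.eventually_eq_of_isLocalMax_norm hH hmax
  obtain ⟨z, h1, h2⟩ := (hstrict.and (hconst.filter_mono nhdsWithin_le_nhds)).exists
  rw [h2] at h1
  exact lt_irrefl _ h1

/-- Comparison of the density with its curvature. -/
theorem exists_prod_rpow_mul_sum_rpow_le {ι : Type*} [Fintype ι] [Nontrivial ι]
    {p : ι → ℂ} (hp : Function.Injective p) {α : ι → ℝ} {β γ : ℝ} (hβ : 0 < β) (hγ : 0 < γ)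
    (hα0 : ∀ i, 0 < α i) (hα : ∀ i, α i ≤ 1 - β) (hsum : 2 * β * γ = ∑ i, α i - 2) :
    ∃ C : ℝ, 0 < C ∧ ∀ x y : ℂ, (∀ i, x - p i * y ≠ 0) → ∃ i j, i ≠ j ∧
      (∏ k, ‖x - p k * y‖ ^ (-α k)) * (∑ k, ‖x - p k * y‖ ^ (2 * β)) ^ γ *
        (∑ k, ‖x - p k * y‖ ^ (2 * β)) ≤
      C * ‖p i - p j‖ * (‖x - p i * y‖ ^ (β - 1) * ‖x - p j * y‖ ^ (β - 1)) := by
  classical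
  obtain ⟨K, hK1, hK⟩ : ∃ K : ℝ, 1 ≤ K ∧
      ∀ i j k, i ≠ k → 1 + 2 * ‖p k - p j‖ / ‖p i - p k‖ ≤ K := by
    obtain ⟨K, hK⟩ := (Set.finite_range
      (fun t : ι × ι × ι => 1 + 2 * ‖p t.2.2 - p t.2.1‖ / ‖p t.1 - p t.2.2‖)).bddAbove
    exact ⟨max 1 K, le_max_left _ _,
      fun i j k _ => (hK ⟨(i, j, k), rfl⟩).trans (le_max_right _ _)⟩
  obtain ⟨δ, hδ1, hδ⟩ : ∃ δ : ℝ, 1 ≤ δ ∧ ∀ i j, ‖p i - p j‖⁻¹ ≤ δ := by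
    obtain ⟨δ, hδ⟩ := (Set.finite_range (fun t : ι × ι => ‖p t.1 - p t.2‖⁻¹)).bddAbove
    exact ⟨max 1 δ, le_max_left _ _, fun i j => (hδ ⟨(i, j), rfl⟩).trans (le_max_right _ _)⟩
  set n : ℝ := (Fintype.card ι : ℝ) with hn
  have hn0 : 0 < n := by
    have := Fintype.card_pos (α := ι)
    positivity
  set A : ℝ := ∑ k, α k with hA
  refine ⟨Real.exp (A * Real.log K + (γ + 1) * Real.log n) * δ, by positivity,
    fun x y hne => ?_⟩
  set L : ι → ℂ := fun k => x - p k * y with hL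
  have hLpos : ∀ k, 0 < ‖L k‖ := fun k => norm_pos_iff.2 (hne k)
  obtain ⟨i, -, hi⟩ := Finset.exists_min_image Finset.univ (fun k => ‖L k‖)
    Finset.univ_nonempty
  obtain ⟨i', hi'⟩ := exists_ne i
  obtain ⟨j, hj, hjmax⟩ := Finset.exists_max_image (Finset.univ.erase i) (fun k => ‖L k‖)
    ⟨i', by simp [hi']⟩
  have hji : j ≠ i := (Finset.mem_erase.1 hj).1
  have hmax : ∀ k, ‖L k‖ ≤ ‖L j‖ := by
    intro k
    by_cases hk : k = i
    · rw [hk]; exact hi j (Finset.mem_univ _)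
    · exact hjmax k (by simp [hk])
  have hcomp : ∀ k, k ≠ i → ‖L j‖ ≤ K * ‖L k‖ := by
    intro k hk
    have hik : 0 < ‖p i - p k‖ := norm_pos_iff.2 (sub_ne_zero.2 (hp.ne hk.symm))
    have h1 : ‖p i - p k‖ * ‖y‖ ≤ 2 * ‖L k‖ := by
      rw [← norm_mul]
      calc ‖(p i - p k) * y‖ = ‖L k - L i‖ := by simp only [hL]; ring_nf
        _ ≤ ‖L k‖ + ‖L i‖ := norm_sub_le _ _
        _ ≤ 2 * ‖L k‖ := by linarith [hi k (Finset.mem_univ _)]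
    have h2 : ‖y‖ ≤ 2 * ‖L k‖ / ‖p i - p k‖ := by
      rw [le_div_iff₀ hik]; linarith
    calc ‖L j‖ = ‖L k + (p k - p j) * y‖ := by simp only [hL]; ring_nf
      _ ≤ ‖L k‖ + ‖p k - p j‖ * ‖y‖ := (norm_add_le _ _).trans_eq (by rw [norm_mul])
      _ ≤ ‖L k‖ + ‖p k - p j‖ * (2 * ‖L k‖ / ‖p i - p k‖) := by gcongr
      _ = (1 + 2 * ‖p k - p j‖ / ‖p i - p k‖) * ‖L k‖ := by ring
      _ ≤ K * ‖L k‖ := by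
        gcongr
        exact hK i j k hk.symm
  refine ⟨i, j, hji.symm, ?_⟩
  set S : ℝ := ∑ k, ‖L k‖ ^ (2 * β) with hS
  have hSpos : 0 < S := Finset.sum_pos (fun k _ => Real.rpow_pos_of_pos (hLpos k) _)
    Finset.univ_nonempty
  have hSle : S ≤ n * ‖L j‖ ^ (2 * β) := by
    calc S ≤ ∑ _k : ι, ‖L j‖ ^ (2 * β) := Finset.sum_le_sum fun k _ =>
          Real.rpow_le_rpow (norm_nonneg _) (hmax k) (by positivity)
      _ = n * ‖L j‖ ^ (2 * β) := by simp [hn]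
  have hlogS : Real.log S ≤ Real.log n + 2 * β * Real.log ‖L j‖ := by
    have := Real.log_le_log hSpos hSle
    rwa [Real.log_mul hn0.ne' (Real.rpow_pos_of_pos (hLpos j) _).ne',
      Real.log_rpow (hLpos j)] at this
  have hlogk : ∀ k, k ≠ i → Real.log ‖L j‖ - Real.log K ≤ Real.log ‖L k‖ := by
    intro k hk
    have := Real.log_le_log (hLpos j) (hcomp k hk)
    rw [Real.log_mul (by positivity) (hLpos k).ne'] at this
    linarith
  have hlogi : Real.log ‖L i‖ ≤ Real.log ‖L j‖ := Real.log_le_log (hLpos i) (hmax i)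
  have hlogK : 0 ≤ Real.log K := Real.log_nonneg hK1
  have hprod : 0 < ∏ k, ‖L k‖ ^ (-α k) :=
    Finset.prod_pos fun k _ => Real.rpow_pos_of_pos (hLpos k) _
  have hlogprod : Real.log (∏ k, ‖L k‖ ^ (-α k)) ≤
      A * Real.log K - (A - α i) * Real.log ‖L j‖ - α i * Real.log ‖L i‖ := by
    rw [Real.log_prod fun k _ => (Real.rpow_pos_of_pos (hLpos k) _).ne']
    have hterm : ∀ k, Real.log (‖L k‖ ^ (-α k)) ≤ α k * Real.log K - α k * Real.log ‖L j‖ +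
        (if k = i then α i * (Real.log ‖L j‖ - Real.log ‖L i‖) else 0) := by
      intro k
      rw [Real.log_rpow (hLpos k)]
      split_ifs with hk
      · have := mul_nonneg (hα0 i).le hlogK
        rw [hk]
        linarith
      · have := mul_le_mul_of_nonneg_left (hlogk k hk) (hα0 k).le
        rw [mul_sub] at this
        linarith
    refine (Finset.sum_le_sum fun k _ => hterm k).trans_eq ?_
    rw [Finset.sum_add_distrib, Finset.sum_sub_distrib, ← Finset.sum_mul, ← Finset.sum_mul,
      Finset.sum_ite_eq' Finset.univ i, if_pos (Finset.mem_univ i), ← hA]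
    ring
  have hri := Real.rpow_pos_of_pos (hLpos i) (β - 1)
  have hrj := Real.rpow_pos_of_pos (hLpos j) (β - 1)
  have hij : 1 ≤ δ * ‖p i - p j‖ := by
    have hpos : 0 < ‖p i - p j‖ := norm_pos_iff.2 (sub_ne_zero.2 (hp.ne hji.symm))
    have := mul_le_mul_of_nonneg_right (hδ i j) hpos.le
    rwa [inv_mul_cancel₀ hpos.ne'] at this
  have hSγ := Real.rpow_pos_of_pos hSpos γ
  suffices h : (∏ k, ‖L k‖ ^ (-α k)) * S ^ γ * S ≤
      Real.exp (A * Real.log K + (γ + 1) * Real.log n) *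
        (‖L i‖ ^ (β - 1) * ‖L j‖ ^ (β - 1)) by
    refine h.trans ?_
    rw [mul_assoc _ δ]
    gcongr
    exact le_mul_of_one_le_right (Real.exp_pos _).le hij
  generalize ∏ k, ‖L k‖ ^ (-α k) = Q at hprod hlogprod ⊢
  clear_value S L
  rw [← Real.log_le_log_iff (by positivity) (by positivity),
    Real.log_mul (by positivity) hSpos.ne', Real.log_mul hprod.ne' hSγ.ne',
    Real.log_mul (Real.exp_pos _).ne' (by positivity), Real.log_mul hri.ne' hrj.ne',
    Real.log_exp, Real.log_rpow hSpos, Real.log_rpow (hLpos i), Real.log_rpow (hLpos j)]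
  have hA' : A = 2 * β * γ + 2 := by linarith
  have h1 : (γ + 1) * Real.log S ≤ (γ + 1) * (Real.log n + 2 * β * Real.log ‖L j‖) := by
    gcongr
  have h2 : 0 ≤ (1 - β - α i) * (Real.log ‖L j‖ - Real.log ‖L i‖) :=
    mul_nonneg (by linarith [hα i]) (by linarith)
  have h3 : (A - α i) * Real.log ‖L j‖ = (2 * β * γ + 2 - α i) * Real.log ‖L j‖ := by rw [hA']
  rw [sub_mul] at hlogprod h3
  linarith

/-- The Wronskian of two functions. -/
noncomputable def wronskian (f g : ℂ → ℂ) (z : ℂ) : ℂ := deriv f z * g z - f z * deriv g z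

/-- The conformal density of an orbifold metric on `ℙ¹`, pulled back along `[g₀ : g₁]`. -/
noncomputable def orbifoldDensity {ι : Type*} [Fintype ι] (p : ι → ℂ) (α : ι → ℝ) (β γ : ℝ)
    (g₀ g₁ : ℂ → ℂ) (z : ℂ) : ℝ :=
  ‖wronskian g₀ g₁ z‖ * (∏ k, ‖g₀ z - p k * g₁ z‖ ^ (-α k)) *
    (∑ k, ‖g₀ z - p k * g₁ z‖ ^ (2 * β)) ^ γ

theorem wronskian_sub_mul_left {g₀ g₁ : ℂ → ℂ} (hg₀ : Differentiable ℂ g₀)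
    (hg₁ : Differentiable ℂ g₁) (c : ℂ) (z : ℂ) :
    wronskian (fun z => g₀ z - c * g₁ z) g₁ z = wronskian g₀ g₁ z := by
  have h : HasDerivAt (fun z => g₀ z - c * g₁ z) (deriv g₀ z - c * deriv g₁ z) z :=
    (hg₀ z).hasDerivAt.sub ((hg₁ z).hasDerivAt.const_mul c)
  simp only [wronskian, h.deriv]
  ring

theorem tendsto_norm_wronskian_mul_norm_rpow {L g : ℂ → ℂ} {z₀ : ℂ} {k : ℕ} {α : ℝ}
    (hL : AnalyticAt ℂ L z₀) (hg : AnalyticAt ℂ g z₀) (hk : analyticOrderAt L z₀ = k)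
    (hα : 0 < α) (hkα : 1 < k * (1 - α)) :
    Tendsto (fun z => ‖wronskian L g z‖ * ‖L z‖ ^ (-α)) (𝓝 z₀) (𝓝 0) := by
  obtain ⟨q, hq, hq0, hLq⟩ := hL.analyticOrderAt_eq_natCast.1 hk
  have hk0 : k ≠ 0 := by
    rintro rfl
    norm_num at hkα
  have hs : 0 < (k : ℝ) - 1 - k * α := by linarith
  set r : ℂ → ℂ := fun z => (k * q z + (z - z₀) * deriv q z) * g z - (z - z₀) * q z * deriv g z
  have hr : ContinuousAt r z₀ := by
    have h1 := hq.continuousAt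
    have h2 := hq.deriv.continuousAt
    have h3 := hg.continuousAt
    have h4 := hg.deriv.continuousAt
    fun_prop
  have heq : (fun z => ‖wronskian L g z‖ * ‖L z‖ ^ (-α)) =ᶠ[𝓝 z₀]
      fun z => ‖z - z₀‖ ^ ((k : ℝ) - 1 - k * α) * (‖r z‖ * ‖q z‖ ^ (-α)) := by
    filter_upwards [hLq, hLq.eventually_nhds, hq.eventually_analyticAt] with z h1 h2 h3
    have hd : HasDerivAt L (k * (z - z₀) ^ (k - 1) * q z + (z - z₀) ^ k * deriv q z) z := by
      have h4 : HasDerivAt (fun w => (w - z₀) ^ k * q w)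
          (k * (z - z₀) ^ (k - 1) * 1 * q z + (z - z₀) ^ k * deriv q z) z :=
        (((hasDerivAt_id z).sub_const z₀).pow k).mul h3.differentiableAt.hasDerivAt
      rw [mul_one] at h4
      exact h4.congr_of_eventuallyEq h2
    have hW : wronskian L g z = (z - z₀) ^ (k - 1) * r z := by
      obtain ⟨n, rfl⟩ := Nat.exists_eq_succ_of_ne_zero hk0
      simp only [wronskian, hd.deriv, h1, r, smul_eq_mul, Nat.succ_eq_add_one,
        Nat.add_sub_cancel]
      ring
    rw [hW, h1]
    by_cases hz : z = z₀
    · subst hz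
      simp [hk0, Real.zero_rpow hs.ne', Real.zero_rpow (neg_ne_zero.2 hα.ne')]
    · have hz' : 0 < ‖z - z₀‖ := norm_pos_iff.2 (sub_ne_zero.2 hz)
      have h5 : ‖z - z₀‖ ^ ((k : ℝ) - 1 - k * α) =
          ‖z - z₀‖ ^ (k - 1) * (‖z - z₀‖ ^ k) ^ (-α) := by
        rw [← Real.rpow_natCast, ← Real.rpow_natCast, ← Real.rpow_mul hz'.le,
          ← Real.rpow_add hz', Nat.cast_pred (Nat.pos_of_ne_zero hk0)]
        congr 1
        ring
      rw [h5, norm_mul, norm_smul, norm_pow, norm_pow,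
        Real.mul_rpow (by positivity) (norm_nonneg _)]
      ring
  refine Tendsto.congr' heq.symm ?_
  have h1 : ContinuousAt (fun z => ‖z - z₀‖ ^ ((k : ℝ) - 1 - k * α)) z₀ :=
    ContinuousAt.rpow_const (by fun_prop) (Or.inr hs.le)
  have h2 : ContinuousAt (fun z => ‖q z‖ ^ (-α)) z₀ :=
    hq.continuousAt.norm.rpow_const (Or.inl (norm_ne_zero_iff.2 hq0))
  have := Tendsto.mul h1.tendsto (Tendsto.mul hr.norm.tendsto h2.tendsto)
  simpa [Real.zero_rpow hs.ne'] using this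

theorem sub_mul_ne_zero_of_ne {p q x y : ℂ} (hpq : p ≠ q) (hxy : x ≠ 0 ∨ y ≠ 0)
    (hx : x - p * y = 0) : x - q * y ≠ 0 := by
  intro hx'
  have hy : (p - q) * y = 0 := by linear_combination hx' - hx
  have hy0 : y = 0 := (mul_eq_zero.1 hy).resolve_left (sub_ne_zero.2 hpq)
  have hx0 : x = 0 := by simpa [hy0] using hx
  exact hxy.elim (· hx0) (· hy0)

theorem continuous_orbifoldDensity {ι : Type*} [Fintype ι] {p : ι → ℂ}
    (hp : Function.Injective p) {α : ι → ℝ} {β γ : ℝ} (hβ : 0 < β) (hγ : 0 < γ)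
    (hα : ∀ i, 0 < α i) {g₀ g₁ : ℂ → ℂ} (hg₀ : Differentiable ℂ g₀) (hg₁ : Differentiable ℂ g₁)
    (hne : ∀ z, g₀ z ≠ 0 ∨ g₁ z ≠ 0)
    (hord : ∀ i z, g₀ z - p i * g₁ z = 0 →
      ∃ k : ℕ, analyticOrderAt (fun z => g₀ z - p i * g₁ z) z = k ∧ 1 < k * (1 - α i)) :
    Continuous (orbifoldDensity p α β γ g₀ g₁) := by
  classical
  have hLd : ∀ i, Differentiable ℂ fun z => g₀ z - p i * g₁ z :=
    fun i => hg₀.sub (hg₁.const_mul _)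
  have hWc : Continuous (wronskian g₀ g₁) := by
    have h1 := hg₀.continuous
    have h2 := hg₁.continuous
    have h3 : Continuous (deriv g₀) := hg₀.contDiff.continuous_deriv le_top
    have h4 : Continuous (deriv g₁) := hg₁.contDiff.continuous_deriv le_top
    unfold wronskian
    fun_prop
  have hSc : Continuous fun z => (∑ k, ‖g₀ z - p k * g₁ z‖ ^ (2 * β)) ^ γ :=
    (continuous_finsetSum _ fun k _ =>
      (hLd k).continuous.norm.rpow_const fun _ => Or.inr (by positivity)).rpow_const
        fun _ => Or.inr hγ.le
  rw [continuous_iff_continuousAt]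
  intro z₀
  refine ContinuousAt.mul ?_ hSc.continuousAt
  have hfac : ∀ k, g₀ z₀ - p k * g₁ z₀ ≠ 0 →
      ContinuousAt (fun z => ‖g₀ z - p k * g₁ z‖ ^ (-α k)) z₀ := fun k hk =>
    (hLd k).continuous.continuousAt.norm.rpow_const (Or.inl (norm_ne_zero_iff.2 hk))
  by_cases hz : ∃ i, g₀ z₀ - p i * g₁ z₀ = 0
  · obtain ⟨i, hi⟩ := hz
    obtain ⟨k, hk, hk1⟩ := hord i z₀ hi
    have hW : ContinuousAt
        (fun z => ‖wronskian g₀ g₁ z‖ * ‖g₀ z - p i * g₁ z‖ ^ (-α i)) z₀ := by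
      have := tendsto_norm_wronskian_mul_norm_rpow ((hLd i).analyticAt z₀) (hg₁.analyticAt z₀)
        hk (hα i) hk1
      simp only [wronskian_sub_mul_left hg₀ hg₁] at this
      simpa [ContinuousAt, hi, Real.zero_rpow (neg_ne_zero.2 (hα i).ne')] using this
    have hP : ContinuousAt
        (fun z => ∏ k ∈ Finset.univ.erase i, ‖g₀ z - p k * g₁ z‖ ^ (-α k)) z₀ :=
      tendsto_finsetProd _ fun k hk => hfac k <|
        sub_mul_ne_zero_of_ne (hp.ne (Finset.ne_of_mem_erase hk).symm) (hne z₀) hi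
    refine (hW.mul hP).congr (Eventually.of_forall fun z => ?_)
    simp only [Pi.mul_apply]
    rw [mul_assoc, Finset.mul_prod_erase Finset.univ
      (fun k => ‖g₀ z - p k * g₁ z‖ ^ (-α k)) (Finset.mem_univ i)]
  · push Not at hz
    exact hWc.norm.continuousAt.mul (tendsto_finsetProd _ fun k _ => hfac k (hz k))

theorem sq_sum_mul_add_le {ι : Type*} [Fintype ι] {w : ι → ℝ} (hw : ∀ k, 0 ≤ w k) (x : ι → ℝ)
    {i j : ι} (hij : i ≠ j) :
    (∑ k, w k * x k) ^ 2 + w i * w j * (x i - x j) ^ 2 ≤ (∑ k, w k * x k ^ 2) * ∑ k, w k := by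
  classical
  have hid : ∑ k, ∑ l, w k * w l * (x k - x l) ^ 2 =
      2 * ((∑ k, w k * x k ^ 2) * ∑ k, w k) - 2 * (∑ k, w k * x k) ^ 2 := by
    have h1 : ∀ k l, w k * w l * (x k - x l) ^ 2 =
        (w k * x k ^ 2) * w l + w k * (w l * x l ^ 2) - 2 * ((w k * x k) * (w l * x l)) := by
      intro k l; ring
    simp only [h1, Finset.sum_sub_distrib, Finset.sum_add_distrib, ← Finset.mul_sum,
      ← Finset.sum_mul]
    ring
  have hnn : ∀ k l, 0 ≤ w k * w l * (x k - x l) ^ 2 := fun k l =>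
    mul_nonneg (mul_nonneg (hw k) (hw l)) (sq_nonneg _)
  have hi : w i * w j * (x i - x j) ^ 2 ≤ ∑ l, w i * w l * (x i - x l) ^ 2 :=
    Finset.single_le_sum (f := fun l => w i * w l * (x i - x l) ^ 2) (fun l _ => hnn i l)
      (Finset.mem_univ j)
  have hj : w j * w i * (x j - x i) ^ 2 ≤ ∑ l, w j * w l * (x j - x l) ^ 2 :=
    Finset.single_le_sum (f := fun l => w j * w l * (x j - x l) ^ 2) (fun l _ => hnn j l)
      (Finset.mem_univ i)
  have hsum : (∑ l, w i * w l * (x i - x l) ^ 2) + ∑ l, w j * w l * (x j - x l) ^ 2 ≤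
      ∑ k, ∑ l, w k * w l * (x k - x l) ^ 2 := by
    rw [← Finset.sum_pair (f := fun k => ∑ l, w k * w l * (x k - x l) ^ 2) hij]
    exact Finset.sum_le_sum_of_subset_of_nonneg (Finset.subset_univ _)
      fun k _ _ => Finset.sum_nonneg fun l _ => hnn k l
  nlinarith

theorem norm_sum_mul_sq_add_le {ι : Type*} [Fintype ι] {w : ι → ℝ} (hw : ∀ k, 0 ≤ w k)
    (u : ι → ℂ) {i j : ι} (hij : i ≠ j) :
    ‖∑ k, (w k : ℂ) * u k‖ ^ 2 + w i * w j * ‖u i - u j‖ ^ 2 ≤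
      (∑ k, w k * ‖u k‖ ^ 2) * ∑ k, w k := by
  have h1 := sq_sum_mul_add_le hw (fun k => (u k).re) hij
  have h2 := sq_sum_mul_add_le hw (fun k => (u k).im) hij
  have e : ∀ v : ℂ, ‖v‖ ^ 2 = v.re ^ 2 + v.im ^ 2 := fun v => by
    rw [Complex.sq_norm, Complex.normSq_apply]; ring
  simp only [e, Complex.re_sum, Complex.im_sum, Complex.re_ofReal_mul, Complex.im_ofReal_mul,
    Complex.sub_re, Complex.sub_im, mul_add, Finset.sum_add_distrib, add_mul]
  linarith

theorem sq_sub_norm_sq_eq {R : ℝ} {z₀ z : ℂ} (hR : 0 < R) (hz₀ : ‖z₀‖ < R) (hz : ‖z‖ ≤ R) :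
    R ^ 2 - ‖z‖ ^ 2 = (R ^ 2 - ‖z₀‖ ^ 2) *
      ‖((R ^ 2 : ℂ) - starRingEnd ℂ z₀ * z) / (R ^ 2 - ‖z₀‖ ^ 2 : ℝ)‖ ^ 2 *
        (1 - ‖R * (z - z₀) / ((R ^ 2 : ℂ) - starRingEnd ℂ z₀ * z)‖ ^ 2) := by
  have hD : 0 < R ^ 2 - ‖z₀‖ ^ 2 := by nlinarith [norm_nonneg z₀]
  have hq : (R ^ 2 : ℂ) - starRingEnd ℂ z₀ * z ≠ 0 := by
    intro h
    have h1 : ‖(R ^ 2 : ℂ)‖ = ‖starRingEnd ℂ z₀ * z‖ := by rw [sub_eq_zero.1 h]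
    rw [norm_mul, RCLike.norm_conj, norm_pow, Complex.norm_real, Real.norm_of_nonneg hR.le] at h1
    nlinarith [norm_nonneg z₀, norm_nonneg z]
  have hq' : 0 < ‖(R ^ 2 : ℂ) - starRingEnd ℂ z₀ * z‖ ^ 2 := by
    have := norm_pos_iff.2 hq
    positivity
  have key : (R ^ 2 - ‖z₀‖ ^ 2) * (R ^ 2 - ‖z‖ ^ 2) =
      ‖(R ^ 2 : ℂ) - starRingEnd ℂ z₀ * z‖ ^ 2 - R ^ 2 * ‖z - z₀‖ ^ 2 := by
    have e : (R ^ 2 : ℂ) = ((R ^ 2 : ℝ) : ℂ) := by push_cast; rfl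
    rw [e]
    simp only [Complex.sq_norm, Complex.normSq_apply, Complex.sub_re, Complex.sub_im,
      Complex.mul_re, Complex.mul_im, Complex.conj_re, Complex.conj_im, Complex.ofReal_re,
      Complex.ofReal_im]
    ring
  rw [norm_div, norm_div, norm_mul, Complex.norm_real, Complex.norm_real,
    Real.norm_of_nonneg hR.le, Real.norm_of_nonneg hD.le, div_pow, div_pow, mul_pow]
  set t := ‖(R ^ 2 : ℂ) - starRingEnd ℂ z₀ * z‖ ^ 2
  field_simp
  linarith

theorem wronskian_sub_mul_sub_mul {g₀ g₁ : ℂ → ℂ} (hg₀ : Differentiable ℂ g₀)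
    (hg₁ : Differentiable ℂ g₁) (p q z : ℂ) :
    wronskian (fun z => g₀ z - p * g₁ z) (fun z => g₀ z - q * g₁ z) z =
      (p - q) * wronskian g₀ g₁ z := by
  have h : ∀ c, HasDerivAt (fun z => g₀ z - c * g₁ z) (deriv g₀ z - c * deriv g₁ z) z := fun c =>
    (hg₀ z).hasDerivAt.sub ((hg₁ z).hasDerivAt.const_mul c)
  simp only [wronskian, (h p).deriv, (h q).deriv]
  ring

theorem exists_orbifoldDensity_mul_le {ι : Type*} [Fintype ι] [Nontrivial ι]
    {p : ι → ℂ} (hp : Function.Injective p) {α : ι → ℝ} {β γ : ℝ} (hβ : 0 < β) (hγ : 0 < γ)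
    (hα0 : ∀ i, 0 < α i) (hα : ∀ i, α i ≤ 1 - β) (hsum : 2 * β * γ = ∑ i, α i - 2) :
    ∃ C : ℝ, 0 < C ∧ ∀ g₀ g₁ : ℂ → ℂ, Differentiable ℂ g₀ → Differentiable ℂ g₁ →
      ∀ (R : ℝ) (z₀ : ℂ), 0 < R → ‖z₀‖ < R → 0 < orbifoldDensity p α β γ g₀ g₁ z₀ →
      (∀ z, ‖z‖ ≤ R → orbifoldDensity p α β γ g₀ g₁ z * (R ^ 2 - ‖z‖ ^ 2) ≤
        orbifoldDensity p α β γ g₀ g₁ z₀ * (R ^ 2 - ‖z₀‖ ^ 2)) →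
      orbifoldDensity p α β γ g₀ g₁ z₀ * (R ^ 2 - ‖z₀‖ ^ 2) ≤ C * R := by
  obtain ⟨C, hC, hB⟩ := exists_prod_rpow_mul_sum_rpow_le hp hβ hγ hα0 hα hsum
  refine ⟨C / β / √γ, by positivity, fun g₀ g₁ hg₀ hg₁ R z₀ hR hz₀ hF hmax => ?_⟩
  set L : ι → ℂ → ℂ := fun k z => g₀ z - p k * g₁ z with hL
  have hLd : ∀ k, Differentiable ℂ (L k) := fun k => hg₀.sub (hg₁.const_mul _)
  have hW0 : wronskian g₀ g₁ z₀ ≠ 0 := by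
    intro h
    simp [orbifoldDensity, h] at hF
  have hL0 : ∀ k, L k z₀ ≠ 0 := by
    intro k hk
    refine hF.ne' ?_
    have : ∏ k, ‖g₀ z₀ - p k * g₁ z₀‖ ^ (-α k) = 0 :=
      Finset.prod_eq_zero (Finset.mem_univ k) (by
        rw [show g₀ z₀ - p k * g₁ z₀ = 0 from hk, norm_zero,
          Real.zero_rpow (neg_ne_zero.2 (hα0 k).ne')])
    simp [orbifoldDensity, this]
  obtain ⟨i, j, hij, hBij⟩ := hB (g₀ z₀) (g₁ z₀) hL0
  change (∏ k, ‖L k z₀‖ ^ (-α k)) * (∑ k, ‖L k z₀‖ ^ (2 * β)) ^ γ *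
    (∑ k, ‖L k z₀‖ ^ (2 * β)) ≤
      C * ‖p i - p j‖ * (‖L i z₀‖ ^ (β - 1) * ‖L j z₀‖ ^ (β - 1)) at hBij
  have hLpos : ∀ k, 0 < ‖L k z₀‖ := fun k => norm_pos_iff.2 (hL0 k)
  set w : ι → ℝ := fun k => ‖L k z₀‖ ^ (2 * β) with hw
  have hwpos : ∀ k, 0 < w k := fun k => Real.rpow_pos_of_pos (hLpos k) _
  set S₀ : ℝ := ∑ k, w k with hS₀
  have hS₀pos : 0 < S₀ := Finset.sum_pos (fun k _ => hwpos k) Finset.univ_nonempty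
  set P₀ : ℝ := ∏ k, ‖L k z₀‖ ^ (-α k) with hP₀
  have hP₀pos : 0 < P₀ := Finset.prod_pos fun k _ => Real.rpow_pos_of_pos (hLpos k) _
  set D : ℝ := R ^ 2 - ‖z₀‖ ^ 2 with hD
  have hDpos : 0 < D := by nlinarith [norm_nonneg z₀]
  set ψ : ι → ℂ → ℂ := fun k z => L k z / L k z₀ with hψ
  have hψ0 : ∀ k, ψ k z₀ = 1 := fun k => div_self (hL0 k)
  have hψa : ∀ k, AnalyticAt ℂ (ψ k) z₀ := fun k => ((hLd k).div_const _).analyticAt z₀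
  have hψs : ∀ k, ψ k z₀ ∈ Complex.slitPlane := fun k => by
    rw [hψ0]; exact Complex.one_mem_slitPlane
  set u : ι → ℂ → ℂ := fun k z => ψ k z ^ (β : ℂ) with hu
  have hu0 : ∀ k, u k z₀ = 1 := fun k => by simp [hu, hψ0]
  have hua : ∀ k, AnalyticAt ℂ (u k) z₀ := fun k => (hψa k).cpow analyticAt_const (hψs k)
  have hud : ∀ k, HasDerivAt (u k) (β * (deriv (L k) z₀ / L k z₀)) z₀ := by
    intro k
    have h1 : HasDerivAt (ψ k) (deriv (L k) z₀ / L k z₀) z₀ :=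
      (hLd k z₀).hasDerivAt.div_const _
    have h2 := h1.cpow_const (c := (β : ℂ)) (hψs k)
    simpa [hψ0] using h2
  set A : ℂ → ℂ := fun z => (∑ k, (w k : ℂ) * u k z) / S₀ with hA
  have hS₀c : (S₀ : ℂ) ≠ 0 := by exact_mod_cast hS₀pos.ne'
  have hA0 : A z₀ = 1 := by
    simp only [hA, hu0, mul_one]
    rw [← Complex.ofReal_sum, ← hS₀, div_self hS₀c]
  have hAa : AnalyticAt ℂ A z₀ :=
    (Finset.analyticAt_fun_sum _ fun k _ => analyticAt_const.mul (hua k)).div analyticAt_const hS₀c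
  set c : ℝ := √(w i * w j) / S₀ with hc
  set b : ℂ → ℂ := fun z => c * (u i z - u j z) / A z with hb
  have hb0 : b z₀ = 0 := by simp [hb, hu0]
  have hbd : HasDerivAt b
      (c * (β * (deriv (L i) z₀ / L i z₀) - β * (deriv (L j) z₀ / L j z₀))) z₀ := by
    have := (((hud i).sub (hud j)).const_mul (c : ℂ)).div
      hAa.differentiableAt.hasDerivAt (by rw [hA0]; exact one_ne_zero)
    have h : b = (fun z => c * (u i z - u j z)) / A := rfl
    rw [h]
    simpa [hA0, hu0] using this
  set q : ℂ → ℂ := fun z => (R ^ 2 : ℂ) - starRingEnd ℂ z₀ * z with hq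
  have hDc : (D : ℂ) ≠ 0 := by exact_mod_cast hDpos.ne'
  have hq0 : q z₀ = D := by
    simp only [hq, hD, Complex.conj_mul']
    push_cast
    ring
  have hqd : HasDerivAt q (-starRingEnd ℂ z₀) z₀ := by
    simpa using ((hasDerivAt_id z₀).const_mul (starRingEnd ℂ z₀)).const_sub (R ^ 2 : ℂ)
  set m : ℂ → ℂ := fun z => R * (z - z₀) / q z with hm
  have hm0 : m z₀ = 0 := by simp [hm]
  have hmd : HasDerivAt m (R / D) z₀ := by
    have h1 : HasDerivAt (fun z => (R : ℂ) * (z - z₀)) R z₀ := by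
      simpa using ((hasDerivAt_id z₀).sub_const z₀).const_mul (R : ℂ)
    have := h1.div hqd (by rw [hq0]; exact hDc)
    rw [hq0] at this
    have h2 : ((R : ℂ) * D - R * (z₀ - z₀) * -starRingEnd ℂ z₀) / (D : ℂ) ^ 2 = R / D := by
      rw [sub_self, mul_zero, zero_mul, sub_zero]
      field_simp
    rwa [h2] at this
  set G : ℂ → ℂ := fun z => wronskian g₀ g₁ z * ∏ k, ψ k z ^ ((-α k : ℝ) : ℂ) with hG
  set H : ℂ → ℂ := fun z => G z * A z ^ ((2 * γ : ℝ) : ℂ) * (q z / D) ^ 2 with hH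
  have hWa : AnalyticAt ℂ (wronskian g₀ g₁) z₀ :=
    ((hg₀.analyticAt z₀).deriv.mul (hg₁.analyticAt z₀)).sub
      ((hg₀.analyticAt z₀).mul (hg₁.analyticAt z₀).deriv)
  have hqa : AnalyticAt ℂ q z₀ := analyticAt_const.sub (analyticAt_const.mul analyticAt_id)
  have hHa : AnalyticAt ℂ H z₀ :=
    ((hWa.mul (Finset.analyticAt_fun_prod _ fun k _ =>
      (hψa k).cpow analyticAt_const (hψs k))).mul
        (hAa.cpow analyticAt_const (by rw [hA0]; exact Complex.one_mem_slitPlane))).mul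
          ((hqa.div analyticAt_const hDc).pow 2)
  have hH0 : H z₀ = wronskian g₀ g₁ z₀ := by
    simp [hH, hG, hψ0, hA0, hq0, div_self hDc]
  have hFeq : ∀ z, orbifoldDensity p α β γ g₀ g₁ z =
      P₀ * ‖G z‖ * (∑ k, w k * ‖u k z‖ ^ 2) ^ γ := by
    intro z
    have e1 : ∀ k (s : ℝ), ‖L k z‖ ^ s = ‖L k z₀‖ ^ s * ‖ψ k z‖ ^ s := by
      intro k s
      rw [← Real.mul_rpow (norm_nonneg _) (norm_nonneg _), ← norm_mul, hψ,
        mul_div_cancel₀ _ (hL0 k)]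
    have e2 : ∀ k, w k * ‖u k z‖ ^ 2 = ‖L k z‖ ^ (2 * β) := by
      intro k
      rw [e1, hu, Complex.norm_cpow_real, ← Real.rpow_natCast, ← Real.rpow_mul (norm_nonneg _)]
      simp only [hw, Nat.cast_ofNat, mul_comm β 2]
    simp only [e2, orbifoldDensity, hG, norm_mul, norm_prod, Complex.norm_cpow_real, hP₀]
    change _ * (∏ k, ‖L k z‖ ^ (-α k)) * _ = _
    simp only [e1 _ (-α _), Finset.prod_mul_distrib]
    ring
  have hle : ∀ᶠ z in 𝓝 z₀, ‖H z‖ * (1 + ‖b z‖ ^ 2) ^ γ * (1 - ‖m z‖ ^ 2) ≤ ‖H z₀‖ := by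
    have hAne : ∀ᶠ z in 𝓝 z₀, A z ≠ 0 :=
      hAa.continuousAt.eventually_ne (by rw [hA0]; exact one_ne_zero)
    have hball : ∀ᶠ z in 𝓝 z₀, ‖z‖ < R := continuous_norm.continuousAt.eventually_lt_const hz₀
    filter_upwards [hAne, hball] with z hAz hzR
    have hSz : S₀ * (‖A z‖ ^ 2 * (1 + ‖b z‖ ^ 2)) ≤ ∑ k, w k * ‖u k z‖ ^ 2 := by
      have h1 := norm_sum_mul_sq_add_le (fun k => (hwpos k).le) (fun k => u k z) hij
      have h2 : ‖∑ k, (w k : ℂ) * u k z‖ = S₀ * ‖A z‖ := by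
        rw [hA, norm_div, Complex.norm_real, Real.norm_of_nonneg hS₀pos.le,
          mul_div_cancel₀ _ hS₀pos.ne']
      have h3 : w i * w j * ‖u i z - u j z‖ ^ 2 = S₀ ^ 2 * (‖A z‖ ^ 2 * ‖b z‖ ^ 2) := by
        have hAz' := norm_ne_zero_iff.2 hAz
        have hbz : ‖b z‖ = c * ‖u i z - u j z‖ / ‖A z‖ := by
          rw [← Real.norm_of_nonneg (show 0 ≤ c by positivity), ← Complex.norm_real, ← norm_mul,
            ← norm_div]
        rw [hbz, hc, div_pow, mul_pow, div_pow, Real.sq_sqrt (mul_pos (hwpos i) (hwpos j)).le]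
        field_simp
      rw [h2, h3] at h1
      refine le_of_mul_le_mul_right ?_ hS₀pos
      linarith
    have hSγ : S₀ ^ γ * (‖A z‖ ^ (2 * γ) * (1 + ‖b z‖ ^ 2) ^ γ) ≤
        (∑ k, w k * ‖u k z‖ ^ 2) ^ γ := by
      have := Real.rpow_le_rpow (by positivity) hSz hγ.le
      rwa [Real.mul_rpow hS₀pos.le (by positivity), Real.mul_rpow (by positivity) (by positivity),
        ← Real.rpow_natCast ‖A z‖ 2, ← Real.rpow_mul (norm_nonneg _), Nat.cast_ofNat] at this
    have hF0 : orbifoldDensity p α β γ g₀ g₁ z₀ = P₀ * ‖H z₀‖ * S₀ ^ γ := by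
      rw [hFeq, hH0]
      simp [hu0, hG, hψ0, hS₀]
    have hm1 := hmax z hzR.le
    have hDz : R ^ 2 - ‖z‖ ^ 2 = D * ‖q z / D‖ ^ 2 * (1 - ‖m z‖ ^ 2) :=
      sq_sub_norm_sq_eq hR hz₀ hzR.le
    have hDz0 : 0 ≤ R ^ 2 - ‖z‖ ^ 2 := by nlinarith [norm_nonneg z]
    have hchain : (P₀ * S₀ ^ γ * D) * (‖H z‖ * (1 + ‖b z‖ ^ 2) ^ γ * (1 - ‖m z‖ ^ 2)) ≤
        (P₀ * S₀ ^ γ * D) * ‖H z₀‖ := by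
      calc _ = P₀ * ‖G z‖ * (S₀ ^ γ * (‖A z‖ ^ (2 * γ) * (1 + ‖b z‖ ^ 2) ^ γ)) *
            (R ^ 2 - ‖z‖ ^ 2) := by
            rw [hDz]
            simp only [hH, norm_mul, norm_pow, Complex.norm_cpow_real]
            ring
        _ ≤ P₀ * ‖G z‖ * (∑ k, w k * ‖u k z‖ ^ 2) ^ γ * (R ^ 2 - ‖z‖ ^ 2) := by gcongr
        _ ≤ _ := by
            rw [← hFeq]
            refine hm1.trans_eq ?_
            rw [hF0]
            ring
    exact le_of_mul_le_mul_left hchain (by positivity)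
  have hfin := mul_norm_deriv_sq_le_of_isLocalMax hγ
    (hHa.eventually_analyticAt.mono fun z hz => hz.differentiableAt) (by rwa [hH0])
    hbd hb0 hmd hm0 hle
  have hbnorm : ‖(c : ℂ) * (β * (deriv (L i) z₀ / L i z₀) - β * (deriv (L j) z₀ / L j z₀))‖ =
      β * (‖p i - p j‖ * (‖L i z₀‖ ^ (β - 1) * ‖L j z₀‖ ^ (β - 1))) *
        ‖wronskian g₀ g₁ z₀‖ / S₀ := by
    have h1 : (c : ℂ) * (β * (deriv (L i) z₀ / L i z₀) - β * (deriv (L j) z₀ / L j z₀)) =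
        c * β * ((p i - p j) * wronskian g₀ g₁ z₀) / (L i z₀ * L j z₀) := by
      rw [← wronskian_sub_mul_sub_mul hg₀ hg₁]
      change _ = _ * (deriv (L i) z₀ * L j z₀ - L i z₀ * deriv (L j) z₀) / _
      have := hL0 i
      have := hL0 j
      field_simp
    have h2 : √(w i * w j) = ‖L i z₀‖ ^ β * ‖L j z₀‖ ^ β := by
      rw [Real.sqrt_eq_iff_mul_self_eq (by positivity) (by positivity)]
      simp only [hw, two_mul, Real.rpow_add (hLpos _)]
      ring
    rw [h1]
    simp only [norm_div, norm_mul, Complex.norm_real]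
    rw [Real.norm_of_nonneg hβ.le, Real.norm_of_nonneg (by positivity), hc, h2,
      Real.rpow_sub_one (hLpos i).ne', Real.rpow_sub_one (hLpos j).ne']
    have := (hLpos i).ne'
    have := (hLpos j).ne'
    field_simp
  have hFle : β * orbifoldDensity p α β γ g₀ g₁ z₀ ≤
      C * ‖(c : ℂ) * (β * (deriv (L i) z₀ / L i z₀) - β * (deriv (L j) z₀ / L j z₀))‖ := by
    rw [hbnorm, mul_div_assoc', le_div_iff₀ hS₀pos]
    have := mul_le_mul_of_nonneg_left hBij (mul_nonneg hβ.le (norm_nonneg (wronskian g₀ g₁ z₀)))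
    calc _ = β * ‖wronskian g₀ g₁ z₀‖ * (P₀ * S₀ ^ γ * S₀) := by
          simp only [orbifoldDensity, hP₀, hS₀, hw, hL]
          ring
      _ ≤ _ := this
      _ = _ := by ring
  set B := ‖(c : ℂ) * (β * (deriv (L i) z₀ / L i z₀) - β * (deriv (L j) z₀ / L j z₀))‖
  have hB1 : √γ * B ≤ R / D := by
    have h1 : ‖(R / D : ℂ)‖ = R / D := by
      rw [norm_div, Complex.norm_real, Complex.norm_real, Real.norm_of_nonneg hR.le,
        Real.norm_of_nonneg hDpos.le]
    rw [h1] at hfin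
    refine le_of_sq_le_sq ?_ (by positivity)
    rwa [mul_pow, Real.sq_sqrt hγ.le]
  rw [le_div_iff₀ hDpos] at hB1
  have hsγ : 0 < √γ := Real.sqrt_pos.2 hγ
  rw [div_div, div_mul_eq_mul_div, le_div_iff₀ (by positivity)]
  calc orbifoldDensity p α β γ g₀ g₁ z₀ * D * (β * √γ) =
        (β * orbifoldDensity p α β γ g₀ g₁ z₀) * (D * √γ) := by ring
    _ ≤ (C * B) * (D * √γ) := by gcongr
    _ = C * (√γ * B * D) := by ring
    _ ≤ C * R := by gcongr

theorem wronskian_eq_zero_of_two_le_order {L g : ℂ → ℂ} {z₀ : ℂ} {k : ℕ}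
    (hL : AnalyticAt ℂ L z₀) (hk : analyticOrderAt L z₀ = k) (hk2 : 2 ≤ k) :
    wronskian L g z₀ = 0 := by
  obtain ⟨q, hq, -, hLq⟩ := hL.analyticOrderAt_eq_natCast.1 hk
  have h : HasDerivAt (fun w => (w - z₀) ^ k * q w)
      (k * (z₀ - z₀) ^ (k - 1) * 1 * q z₀ + (z₀ - z₀) ^ k * deriv q z₀) z₀ :=
    (((hasDerivAt_id z₀).sub_const z₀).pow k).mul hq.differentiableAt.hasDerivAt
  have hd := h.congr_of_eventuallyEq hLq
  have hk0 : k ≠ 0 := by lia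
  have hk1 : k - 1 ≠ 0 := by lia
  simp [wronskian, hd.deriv, hLq.self_of_nhds, hk0, hk1]

/-- Nevanlinna's ramified form of Picard's theorem: a holomorphic map `[g₀ : g₁]` from `ℂ` to `ℙ¹`
that is sufficiently ramified over the points `p i` has vanishing Wronskian. -/
theorem wronskian_eq_zero_of_ramified {ι : Type*} [Fintype ι] [Nontrivial ι] {p : ι → ℂ}
    (hp : Function.Injective p) {α : ι → ℝ} {β : ℝ} (hβ : 0 < β)
    (hα0 : ∀ i, 0 < α i) (hα : ∀ i, α i ≤ 1 - β) (hsum : 2 < ∑ i, α i)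
    {g₀ g₁ : ℂ → ℂ} (hg₀ : Differentiable ℂ g₀) (hg₁ : Differentiable ℂ g₁)
    (hne : ∀ z, g₀ z ≠ 0 ∨ g₁ z ≠ 0)
    (hord : ∀ i z, g₀ z - p i * g₁ z = 0 →
      ∃ k : ℕ, analyticOrderAt (fun z => g₀ z - p i * g₁ z) z = k ∧ 1 < k * (1 - α i)) (z : ℂ) :
    wronskian g₀ g₁ z = 0 := by
  set γ : ℝ := (∑ i, α i - 2) / (2 * β) with hγdef
  have hγ : 0 < γ := div_pos (by linarith) (by positivity)
  obtain ⟨C, hC, hbound⟩ := exists_orbifoldDensity_mul_le hp hβ hγ hα0 hα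
    (by rw [hγdef]; field_simp)
  set F := orbifoldDensity p α β γ g₀ g₁ with hF
  have hFc : Continuous F := continuous_orbifoldDensity hp hβ hγ hα0 hg₀ hg₁ hne hord
  have hFR : ∀ R : ℝ, ‖z‖ < R → F z * (R ^ 2 - ‖z‖ ^ 2) ≤ C * R := by
    intro R hzR
    have hR : 0 < R := (norm_nonneg z).trans_lt hzR
    obtain ⟨z₀, hz₀, hmax⟩ := (isCompact_closedBall (0 : ℂ) R).exists_isMaxOn
      ⟨0, by simp [hR.le]⟩ (f := fun z => F z * (R ^ 2 - ‖z‖ ^ 2))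
      (by fun_prop)
    have hz₀' : ‖z₀‖ ≤ R := by simpa using hz₀
    have hmax' : ∀ w, ‖w‖ ≤ R → F w * (R ^ 2 - ‖w‖ ^ 2) ≤ F z₀ * (R ^ 2 - ‖z₀‖ ^ 2) :=
      fun w hw => hmax (by simpa using hw)
    refine (hmax' z hzR.le).trans ?_
    by_cases hpos : 0 < F z₀ * (R ^ 2 - ‖z₀‖ ^ 2)
    · have hD : 0 ≤ R ^ 2 - ‖z₀‖ ^ 2 := by nlinarith [norm_nonneg z₀]
      have hFpos : 0 < F z₀ := pos_of_mul_pos_left hpos hD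
      have hDpos : 0 < R ^ 2 - ‖z₀‖ ^ 2 := pos_of_mul_pos_right hpos hFpos.le
      exact hbound g₀ g₁ hg₀ hg₁ R z₀ hR (by nlinarith [norm_nonneg z₀]) hFpos hmax'
    · exact (not_lt.1 hpos).trans (by positivity)
  have hF0 : F z ≤ 0 := by
    by_contra! hpos
    set R : ℝ := 2 * ‖z‖ + 1 + 2 * C / F z with hRdef
    have hCF : 0 < 2 * C / F z := by positivity
    have h1 := hFR R (by linarith [norm_nonneg z])
    have h2 : F z * (2 * C / F z) = 2 * C := by field_simp
    have h3 : 2 * C < F z * R := by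
      rw [hRdef, mul_add, h2]
      have : 0 < F z * (2 * ‖z‖ + 1) := by positivity
      linarith
    have h4 : R ^ 2 / 2 ≤ R ^ 2 - ‖z‖ ^ 2 := by nlinarith [norm_nonneg z]
    have h5 := mul_le_mul_of_nonneg_left h4 hpos.le
    have hR : 0 < R := by linarith [norm_nonneg z]
    nlinarith
  by_cases hz : ∃ i, g₀ z - p i * g₁ z = 0
  · obtain ⟨i, hi⟩ := hz
    obtain ⟨k, hk, hk1⟩ := hord i z hi
    rw [← wronskian_sub_mul_left hg₀ hg₁ (p i)]
    refine wronskian_eq_zero_of_two_le_order ((hg₀.sub (hg₁.const_mul _)).analyticAt z) hk ?_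
    by_contra! hk2
    have : (k : ℝ) ≤ 1 := by exact_mod_cast Nat.le_of_lt_succ hk2
    nlinarith [hα0 i, hα i]
  · push Not at hz
    by_contra hW
    refine hF0.not_gt ?_
    have h1 : ∀ (s : ℝ) k, 0 < ‖g₀ z - p k * g₁ z‖ ^ s := fun s k =>
      Real.rpow_pos_of_pos (norm_pos_iff.2 (hz k)) s
    exact mul_pos (mul_pos (norm_pos_iff.2 hW) (Finset.prod_pos fun k _ => h1 _ k))
      (Real.rpow_pos_of_pos (Finset.sum_pos (fun k _ => h1 _ k) Finset.univ_nonempty) _)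

theorem mul_eq_mul_of_wronskian_eq_zero {g₀ g₁ : ℂ → ℂ} (hg₀ : Differentiable ℂ g₀)
    (hg₁ : Differentiable ℂ g₁) (hW : ∀ z, wronskian g₀ g₁ z = 0) {z₀ : ℂ} (hz₀ : g₁ z₀ ≠ 0)
    (z : ℂ) : g₁ z₀ * g₀ z = g₀ z₀ * g₁ z := by
  obtain ⟨r, hr, hball⟩ := Metric.eventually_nhds_iff_ball.1
    (hg₁.continuous.continuousAt.eventually_ne hz₀)
  have hder : ∀ w ∈ Metric.ball z₀ r, HasDerivAt (fun w => g₀ w / g₁ w) 0 w := by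
    intro w hw
    have := (hg₀ w).hasDerivAt.div (hg₁ w).hasDerivAt (hball w hw)
    rwa [show deriv g₀ w * g₁ w - g₀ w * deriv g₁ w = 0 from hW w, zero_div] at this
  have heq : (fun w => g₁ z₀ * g₀ w) =ᶠ[𝓝 z₀] fun w => g₀ z₀ * g₁ w := by
    filter_upwards [Metric.ball_mem_nhds z₀ hr] with w hw
    have h : g₀ w / g₁ w = g₀ z₀ / g₁ z₀ :=
      Metric.isOpen_ball.is_const_of_deriv_eq_zero (convex_ball z₀ r).isPreconnected
        (fun v hv => (hder v hv).differentiableAt.differentiableWithinAt)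
        (fun v hv => (hder v hv).deriv) hw (Metric.mem_ball_self hr)
    have := hball w hw
    field_simp at h
    linear_combination h
  exact congrFun (AnalyticOnNhd.eq_of_eventuallyEq
    (fun w _ => (hg₀.const_mul _).analyticAt w) (fun w _ => (hg₁.const_mul _).analyticAt w) heq) z

theorem dvd_mul_of_pow_eq_pow_mul {f P h : ℂ → ℂ} {z₀ : ℂ} {d n k : ℕ} (hf : AnalyticAt ℂ f z₀)
    (hP : AnalyticAt ℂ P z₀) (hh : AnalyticAt ℂ h z₀) (hP0 : P z₀ ≠ 0) (hd : d ≠ 0)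
    (hk : analyticOrderAt f z₀ = k) (heq : ∀ z, h z ^ d = f z ^ n * P z) : d ∣ n * k := by
  have h1 : h ^ d = f ^ n * P := funext heq
  have h2 := congrArg (analyticOrderAt · z₀) h1
  simp only [analyticOrderAt_pow hh, analyticOrderAt_mul (hf.pow n) hP, analyticOrderAt_pow hf,
    hP.analyticOrderAt_eq_zero.2 hP0, add_zero, hk, nsmul_eq_mul] at h2
  have htop : analyticOrderAt h z₀ ≠ ⊤ := by
    intro ht
    rw [ht, ENat.mul_top (by exact_mod_cast hd)] at h2
    exact ENat.natCast_ne_top (n * k) (by exact_mod_cast h2.symm)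
  obtain ⟨s, hs⟩ := ENat.ne_top_iff_exists.1 htop
  rw [← hs] at h2
  exact ⟨s, by exact_mod_cast h2.symm⟩

theorem exists_analyticOrderAt_eq_natCast {f : ℂ → ℂ} (hf : Differentiable ℂ f)
    (hne : ∃ z, f z ≠ 0) (z₀ : ℂ) : ∃ k : ℕ, analyticOrderAt f z₀ = k := by
  have htop : analyticOrderAt f z₀ ≠ ⊤ := by
    intro ht
    obtain ⟨z, hz⟩ := hne
    refine hz (congrFun (AnalyticOnNhd.eq_of_eventuallyEq (g := fun _ => 0)
      (fun w _ => hf.analyticAt w) (fun w _ => analyticAt_const) (analyticOrderAt_eq_top.1 ht)) z)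
  obtain ⟨k, hk⟩ := ENat.ne_top_iff_exists.1 htop
  exact ⟨k, hk.symm⟩

/-- The orbifold Euler characteristic bound implied by the numerical conditions. -/
theorem two_lt_sum_one_sub_gcd_div {d l m : ℕ} (hd : 2 ≤ d) (hdm : d ∣ m)
    {a : Fin l → ℕ} (ha : ∀ i, 0 < a i) (hsum : ∑ i, a i = m)
    (hcase : ((2 ∣ d ∨ 3 ∣ d) ∧ m / d + 3 ≤ l) ∨ (Nat.Coprime d 6 ∧ m / d + 2 ≤ l)) :
    2 < ∑ i : {i // ¬ d ∣ a i}, (1 - (Nat.gcd d (a i) : ℝ) / d) := by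
  classical
  have hd0 : (0 : ℝ) < d := by positivity
  obtain ⟨t, rfl⟩ := hdm
  rw [Nat.mul_div_cancel_left _ (by lia)] at hcase
  have hall : (l : ℝ) - t = ∑ i, (1 - (a i : ℝ) / d) := by
    rw [Finset.sum_sub_distrib, ← Finset.sum_div, ← Nat.cast_sum, hsum]
    simp
    field_simp
  have hsub : ∀ f : Fin l → ℝ, ∑ i : {i // ¬ d ∣ a i}, f i = ∑ i with ¬ d ∣ a i, f i := fun f =>
    (Finset.sum_subtype _ (by simp) f).symm
  have h1 : (l : ℝ) - t ≤ ∑ i : {i // ¬ d ∣ a i}, (1 - (a i : ℝ) / d) := by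
    rw [hall, hsub fun i => 1 - (a i : ℝ) / d, ← Finset.sum_filter_add_sum_filter_not Finset.univ
      (fun i => ¬ d ∣ a i)]
    refine add_le_of_nonpos_right (Finset.sum_nonpos fun i hi => ?_)
    have : d ∣ a i := by simpa using hi
    have hle : (d : ℝ) ≤ a i := by exact_mod_cast Nat.le_of_dvd (ha i) this
    have := (one_le_div hd0).2 hle
    linarith
  rcases hcase with ⟨-, hl⟩ | ⟨hco, hl⟩
  · have h2 : (t : ℝ) + 3 ≤ l := by exact_mod_cast hl
    have h3 : ∑ i : {i // ¬ d ∣ a i}, (1 - (a i : ℝ) / d) ≤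
        ∑ i : {i // ¬ d ∣ a i}, (1 - (Nat.gcd d (a i) : ℝ) / d) := by
      gcongr with i
      exact Nat.gcd_le_right _ (ha i)
    linarith
  · have h2 : (t : ℝ) + 2 ≤ l := by exact_mod_cast hl
    set n := Fintype.card {i // ¬ d ∣ a i} with hn
    have hn3 : 3 ≤ n := by
      have h4 : (2 : ℝ) < n ∨ n = 0 := by
        by_cases h0 : n = 0
        · exact Or.inr h0
        refine Or.inl ?_
        have : Nonempty {i // ¬ d ∣ a i} := Fintype.card_pos_iff.1 (Nat.pos_of_ne_zero h0)
        calc (2 : ℝ) ≤ ∑ i : {i // ¬ d ∣ a i}, (1 - (a i : ℝ) / d) := by linarith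
          _ < ∑ _i : {i // ¬ d ∣ a i}, (1 : ℝ) := by
            refine Finset.sum_lt_sum_of_nonempty Finset.univ_nonempty fun i _ => ?_
            have : (0 : ℝ) < a i := by exact_mod_cast ha i
            have : 0 < (a i : ℝ) / d := by positivity
            linarith
          _ = n := by simp [hn]
      rcases h4 with h4 | h4
      · exact_mod_cast h4
      · have := Fintype.card_eq_zero_iff.1 h4
        simp only [Finset.univ_eq_empty, Finset.sum_empty] at h1
        linarith
    have h5 : ∀ i : {i // ¬ d ∣ a i}, (4 : ℝ) / 5 ≤ 1 - (Nat.gcd d (a i) : ℝ) / d := by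
      rintro ⟨i, hi⟩
      obtain ⟨e, he⟩ := Nat.gcd_dvd_left d (a i)
      have hg : 0 < Nat.gcd d (a i) := Nat.gcd_pos_of_pos_left _ (by lia)
      have he5 : 5 ≤ e := by
        have hco' : Nat.Coprime e 6 := hco.coprime_dvd_left ⟨_, by rw [mul_comm]; exact he⟩
        by_contra! hlt
        interval_cases e
        · lia
        · exact hi (by rw [mul_one] at he; rw [he]; exact Nat.gcd_dvd_right _ _)
        all_goals revert hco'; decide
      have : 5 * (Nat.gcd d (a i) : ℝ) ≤ d := by
        have h6 : 5 * Nat.gcd d (a i) ≤ d := by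
          conv_rhs => rw [he]
          nlinarith
        exact_mod_cast h6
      have : (Nat.gcd d (a i) : ℝ) / d ≤ 1 / 5 := by
        rw [div_le_div_iff₀ hd0 (by norm_num)]
        linarith
      change (4 : ℝ) / 5 ≤ 1 - (Nat.gcd d (a i) : ℝ) / d
      linarith
    have h7 : (n : ℝ) * (4 / 5) ≤ ∑ i : {i // ¬ d ∣ a i}, (1 - (Nat.gcd d (a i) : ℝ) / d) := by
      have := Finset.sum_le_sum fun i (_ : i ∈ Finset.univ) => h5 i
      simpa [hn] using this
    have h8 : (3 : ℝ) ≤ n := by exact_mod_cast hn3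
    linarith

/-- Brody hyperbolicity of the degree `d` cyclic cover of ℙ¹ branched along
`a₁ p₁ + ⋯ + a_l p_l`: under the numerical conditions, any entire solution of
`h^d = ∏ (g₀ - pᵢ g₁)^{aᵢ}` with `g₀, g₁` having no common zero has `g₀, g₁`
linearly dependent over ℂ. -/
theorem cyclic_cover_P1_brody_hyperbolic
    (d l m : ℕ) (hd : 2 ≤ d) (hl : 0 < l) (hm : 0 < m) (hdm : d ∣ m)
    (p : Fin l → ℂ) (hp : Function.Injective p)
    (a : Fin l → ℕ) (ha : ∀ i, 0 < a i) (hsum : ∑ i, a i = m)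
    (hcase : ((2 ∣ d ∨ 3 ∣ d) ∧ m / d + 3 ≤ l) ∨ (Nat.Coprime d 6 ∧ m / d + 2 ≤ l))
    (g₀ g₁ h : ℂ → ℂ)
    (hg₀ : Differentiable ℂ g₀) (hg₁ : Differentiable ℂ g₁) (hh : Differentiable ℂ h)
    (hnczero : ∀ z : ℂ, g₀ z ≠ 0 ∨ g₁ z ≠ 0)
    (heq : ∀ z : ℂ, h z ^ d = ∏ i, (g₀ z - p i * g₁ z) ^ a i) :
    ∃ c₀ c₁ : ℂ, (c₀ ≠ 0 ∨ c₁ ≠ 0) ∧ ∀ z : ℂ, c₁ * g₀ z = c₀ * g₁ z := by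
  classical
  have hd0 : (0 : ℝ) < d := by positivity
  by_cases hzero : ∃ i, ∀ z, g₀ z - p i * g₁ z = 0
  · obtain ⟨i, hi⟩ := hzero
    exact ⟨p i, 1, Or.inr one_ne_zero, fun z => by linear_combination hi z⟩
  push Not at hzero
  by_cases hg : ∀ z, g₁ z = 0
  · exact ⟨1, 0, Or.inl one_ne_zero, fun z => by simp [hg z]⟩
  push Not at hg
  obtain ⟨z₀, hz₀⟩ := hg
  refine ⟨g₀ z₀, g₁ z₀, Or.inr hz₀, mul_eq_mul_of_wronskian_eq_zero hg₀ hg₁ ?_ hz₀⟩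
  have hbig := two_lt_sum_one_sub_gcd_div hd hdm ha hsum hcase
  set ι := {i // ¬ d ∣ a i}
  set e : ι → ℝ := fun i => 1 - (Nat.gcd d (a i) : ℝ) / d with he
  have hgcd : ∀ i : ι, 2 * (Nat.gcd d (a i) : ℝ) ≤ d := by
    rintro ⟨i, hi⟩
    obtain ⟨s, hs⟩ := Nat.gcd_dvd_left d (a i)
    have hs2 : 2 ≤ s := by
      by_contra! hlt
      interval_cases s
      · lia
      · exact hi (by rw [mul_one] at hs; rw [hs]; exact Nat.gcd_dvd_right _ _)
    have h6 : 2 * Nat.gcd d (a i) ≤ d := by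
      conv_rhs => rw [hs]
      nlinarith
    exact_mod_cast h6
  have he2 : ∀ i, 1 / 2 ≤ e i := by
    intro i
    have : (Nat.gcd d (a i) : ℝ) / d ≤ 1 / 2 := by
      rw [div_le_div_iff₀ hd0 (by norm_num)]
      linarith [hgcd i]
    simp only [he]
    linarith
  have he1 : ∀ i, e i < 1 := by
    intro i
    have : (0 : ℝ) < Nat.gcd d (a i) := by
      exact_mod_cast Nat.gcd_pos_of_pos_left _ (by lia)
    have : 0 < (Nat.gcd d (a i) : ℝ) / d := by positivity
    simp only [he]
    linarith
  set n : ℝ := (Fintype.card ι : ℝ) with hn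
  have hlt : ∑ i, e i ≤ n := by
    have := Finset.sum_le_sum fun i (_ : i ∈ Finset.univ) => (he1 i).le
    simpa [hn] using this
  have hn2 : 2 < n := hbig.trans_le hlt
  have : Nontrivial ι := Fintype.one_lt_card_iff_nontrivial.1 (by
    have : 2 < Fintype.card ι := by
      have hn2' : (2 : ℝ) < (Fintype.card ι : ℝ) := hn2
      exact_mod_cast hn2'
    lia)
  set η : ℝ := (∑ i, e i - 2) / (2 * n) with hη
  have hηpos : 0 < η := div_pos (by linarith) (by linarith)
  have hη2 : η < 1 / 2 := by
    rw [hη, div_lt_div_iff₀ (by linarith) (by norm_num)]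
    linarith
  have hnη : n * η = (∑ i, e i - 2) / 2 := by
    rw [hη]
    field_simp
  refine wronskian_eq_zero_of_ramified (p := fun i : ι => p i) (α := fun i => e i - η)
    (hp.comp Subtype.val_injective) hηpos (fun i => by linarith [he2 i])
    (fun i => by linarith [he1 i]) ?_ hg₀ hg₁ hnczero ?_
  · rw [Finset.sum_sub_distrib, Finset.sum_const, Finset.card_univ, nsmul_eq_mul, ← hn, hnη]
    linarith
  · intro i z hz
    have hLd : ∀ j, Differentiable ℂ fun z => g₀ z - p j * g₁ z :=
      fun j => hg₀.sub (hg₁.const_mul _)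
    obtain ⟨k, hk⟩ := exists_analyticOrderAt_eq_natCast (hLd i) (hzero i) z
    refine ⟨k, hk, ?_⟩
    have hk0 : 0 < k := by
      rw [Nat.pos_iff_ne_zero]
      rintro rfl
      exact ((hLd i).analyticAt z).analyticOrderAt_eq_zero.1 hk hz
    have hdvd : d ∣ a i * k := by
      refine dvd_mul_of_pow_eq_pow_mul ((hLd i).analyticAt z)
        (P := fun z => ∏ j ∈ Finset.univ.erase i.1, (g₀ z - p j * g₁ z) ^ a j)
        (Finset.analyticAt_fun_prod _ fun j _ => ((hLd j).analyticAt z).pow _)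
        (hh.analyticAt z) ?_ (by lia) hk fun w => ?_
      · exact Finset.prod_ne_zero_iff.2 fun j hj => pow_ne_zero _ <|
          sub_mul_ne_zero_of_ne (hp.ne (Finset.ne_of_mem_erase hj).symm) (hnczero z) hz
      · rw [heq, Finset.mul_prod_erase Finset.univ (fun j => (g₀ w - p j * g₁ w) ^ a j)
          (Finset.mem_univ i.1)]
    have hdk : (d : ℝ) ≤ Nat.gcd d (a i) * k := by
      have h1 : d ∣ Nat.gcd d (a i) * k := by
        rw [← Nat.gcd_mul_right]
        exact Nat.dvd_gcd (dvd_mul_right _ _) hdvd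
      have h2 : d ≤ Nat.gcd d (a i) * k :=
        Nat.le_of_dvd (Nat.mul_pos (Nat.gcd_pos_of_pos_left _ (by lia)) hk0) h1
      exact_mod_cast h2
    have hk1 : 1 ≤ (k : ℝ) * ((Nat.gcd d (a i) : ℝ) / d) := by
      rw [mul_div_assoc', le_div_iff₀ hd0]
      linarith
    have hkη : 0 < (k : ℝ) * η := by positivity
    simp only [he]
    linarith
end

section
/- Let d ≥ 2 and l be positive integers, let p_1, …, p_l be distinct complex numbers, and let a_1, …, a_l be positive integers. Assume that either (i) d divides a_i for every i, or (ii) d is even, a_1 ≡ d/2 (mod d), a_2 ≡ d/2 (mod d), and d divides a_i for every i ≥ 3. Then there exist entire functions g, h : ℂ → ℂ with g non-constant such that h(z)^d = ∏_{i=1}^{l} (g(z) − p_i)^{a_i} for all z ∈ ℂ. -/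
/-- A root of the product with exponents reduced modulo `d` gives a root of the full product. -/
theorem exists_pow_eq_prod_of_pow_eq_prod_mod {ι : Type*} [Fintype ι] (d : ℕ) (p : ι → ℂ)
    (a : ι → ℕ) {g u : ℂ → ℂ} (hg : Differentiable ℂ g) (hu : Differentiable ℂ u)
    (h : ∀ z, u z ^ d = ∏ i, (g z - p i) ^ (a i % d)) :
    ∃ f : ℂ → ℂ, Differentiable ℂ f ∧ ∀ z, f z ^ d = ∏ i, (g z - p i) ^ a i := by
  refine ⟨fun z => u z * ∏ i, (g z - p i) ^ (a i / d), by fun_prop, fun z => ?_⟩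
  rw [mul_pow, h, ← Finset.prod_pow, ← Finset.prod_mul_distrib]
  refine Finset.prod_congr rfl fun i _ => ?_
  rw [← pow_mul, ← pow_add, mul_comm (a i / d), Nat.mod_add_div]


/-- Converse direction of Table 2: if `d` divides every `aᵢ`, or if `d` is even,
`a₁ ≡ a₂ ≡ d/2 (mod d)` and `d ∣ aᵢ` for `i ≥ 3`, then the degree `d` cyclic
cover of 𝔸¹ branched along `a₁ p₁ + ⋯ + a_l p_l` is not Brody hyperbolic:
there is an entire solution `(g, h)` of `h^d = ∏ (g - pᵢ)^{aᵢ}` with `g`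
non-constant. -/
theorem cyclic_cover_A1_not_hyperbolic
    (d l : ℕ) (hd : 2 ≤ d) (hl : 0 < l)
    (p : Fin l → ℂ) (hp : Function.Injective p)
    (a : Fin l → ℕ) (ha : ∀ i, 0 < a i)
    (hcase : (∀ i, d ∣ a i) ∨
      (Even d ∧ ∃ h₁ : 1 < l,
        a ⟨0, by omega⟩ % d = d / 2 ∧ a ⟨1, h₁⟩ % d = d / 2 ∧
        ∀ i : Fin l, 2 ≤ (i : ℕ) → d ∣ a i)) :
    ∃ g h : ℂ → ℂ, Differentiable ℂ g ∧ Differentiable ℂ h ∧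
      (∃ z w : ℂ, g z ≠ g w) ∧
      ∀ z : ℂ, h z ^ d = ∏ i, (g z - p i) ^ a i := by
  rcases hcase with h | ⟨⟨e, rfl⟩, h₁, h0, h1, h2⟩
  · obtain ⟨f, hf, hfp⟩ := exists_pow_eq_prod_of_pow_eq_prod_mod d p a (g := fun z => z)
      (u := fun _ => 1) (by fun_prop) (by fun_prop)
      (fun z => by simp [fun i => Nat.mod_eq_zero_of_dvd (h i)])
    exact ⟨fun z => z, f, by fun_prop, hf, ⟨0, 1, zero_ne_one⟩, hfp⟩
  · obtain ⟨n, rfl⟩ : ∃ n, l = n + 2 := ⟨l - 2, by omega⟩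
    have he : (e + e) / 2 = e := by omega
    rw [he] at h0 h1
    have hne : p 0 ≠ p 1 := fun h => by simpa using hp h
    let g : ℂ → ℂ := fun z => (p 0 + p 1) / 2 + (p 0 - p 1) / 2 * Complex.cos z
    have hg : Differentiable ℂ g := by fun_prop
    obtain ⟨f, hf, hfp⟩ := exists_pow_eq_prod_of_pow_eq_prod_mod (e + e) p a hg
      (u := fun z => Complex.I * ((p 0 - p 1) / 2) * Complex.sin z) (by fun_prop) (fun z => by
        have hrest (i : Fin n) : a i.succ.succ % (e + e) = 0 :=
          Nat.mod_eq_zero_of_dvd (h2 _ (by simp))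
        have h0' : a 0 % (e + e) = e := h0
        have h1' : a (Fin.succ 0) % (e + e) = e := h1
        simp only [Fin.prod_univ_succ, hrest, h0', h1', pow_zero, Finset.prod_const_one, mul_one]
        rw [pow_add, ← mul_pow, ← mul_pow]
        congr 1
        simp only [Fin.succ_zero_eq_one, g]
        linear_combination ((p 0 - p 1) / 2) ^ 2 * Complex.sin z ^ 2 * Complex.I_sq -
          ((p 0 - p 1) / 2) ^ 2 * Complex.sin_sq_add_cos_sq z)
    refine ⟨g, f, hg, hf, ⟨0, Real.pi, fun h => hne ?_⟩, hfp⟩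
    simp only [g, Complex.cos_zero, Complex.cos_pi] at h
    linear_combination h
end

section
/- Let d ≥ 2 and l ≥ 2 be integers, let p_1, …, p_l be distinct complex numbers, and let a_1, …, a_l be positive integers such that d does not divide a_1, d divides a_1 + a_2, and d divides a_i for every i ≥ 3. Then there exist entire functions g_0, g_1, h : ℂ → ℂ such that g_0 and g_1 have no common zero, g_0 and g_1 are linearly independent over ℂ, and h(z)^d = ∏_{i=1}^{l} (g_0(z) − p_i g_1(z))^{a_i} for all z ∈ ℂ. -/
/-- Converse direction of the row of Table 1 with exactly two branching
multiplicities not divisible by `d`, whose residues sum to `0 mod d`: the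
corresponding cyclic cover of ℙ¹ is not Brody hyperbolic, i.e. there is an
entire solution `(g₀, g₁, h)` of `h^d = ∏ (g₀ - pᵢ g₁)^{aᵢ}` with `g₀, g₁`
having no common zero and linearly independent over ℂ. -/
theorem cyclic_cover_P1_not_hyperbolic
    (d l : ℕ) (hd : 2 ≤ d) (hl : 2 ≤ l)
    (p : Fin l → ℂ) (hp : Function.Injective p)
    (a : Fin l → ℕ) (ha : ∀ i, 0 < a i)
    (ha1 : ¬ d ∣ a ⟨0, by omega⟩) (ha12 : d ∣ (a ⟨0, by omega⟩ + a ⟨1, by omega⟩))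
    (hrest : ∀ i : Fin l, 2 ≤ (i : ℕ) → d ∣ a i) :
    ∃ g₀ g₁ h : ℂ → ℂ,
      Differentiable ℂ g₀ ∧ Differentiable ℂ g₁ ∧ Differentiable ℂ h ∧
      (∀ z : ℂ, g₀ z ≠ 0 ∨ g₁ z ≠ 0) ∧
      (¬ ∃ c₀ c₁ : ℂ, (c₀ ≠ 0 ∨ c₁ ≠ 0) ∧ ∀ z : ℂ, c₁ * g₀ z = c₀ * g₁ z) ∧
      ∀ z : ℂ, h z ^ d = ∏ i, (g₀ z - p i * g₁ z) ^ a i := by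
  set i₀ : Fin l := ⟨0, by omega⟩ with hi₀
  set i₁ : Fin l := ⟨1, by omega⟩ with hi₁
  have hne : i₁ ≠ i₀ := by simp [hi₀, hi₁]
  have hsub : p i₁ - p i₀ ≠ 0 := sub_ne_zero.mpr (hp.ne hne)
  let g₁ : ℂ → ℂ := fun z => (z ^ d - 1) / (p i₁ - p i₀)
  let g₀ : ℂ → ℂ := fun z => 1 + p i₁ * g₁ z
  let h : ℂ → ℂ := fun z => ∏ i,
    if i = i₀ then z ^ a i else if i = i₁ then 1 else (g₀ z - p i * g₁ z) ^ (a i / d)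
  have hg₁ : Differentiable ℂ g₁ := by fun_prop
  have hg₀ : Differentiable ℂ g₀ := by fun_prop
  have h₀ (z : ℂ) : g₀ z - p i₀ * g₁ z = z ^ d := by
    simp only [g₀, g₁]
    field_simp
    ring
  have h₁ (z : ℂ) : g₀ z - p i₁ * g₁ z = 1 := by simp [g₀]
  refine ⟨g₀, g₁, h, hg₀, hg₁, ?_, ?_, ?_, ?_⟩
  · refine Differentiable.fun_finsetProd fun i _ => ?_
    split_ifs <;> fun_prop
  · intro z
    by_contra! hz
    simpa [hz.1, hz.2] using h₁ z
  · rintro ⟨c₀, c₁, hc, hlin⟩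
    have hc₁ : c₁ = 0 := by simpa [g₀, g₁] using hlin 1
    have hc₀ : c₀ = 0 := by
      simpa [g₁, hc₁, hsub, show d ≠ 0 by omega] using hlin 0
    simp [hc₀, hc₁] at hc
  · intro z
    simp only [h, ← Finset.prod_pow]
    refine Finset.prod_congr rfl fun i _ => ?_
    split_ifs with hi hi'
    · rw [hi, h₀, ← pow_mul, ← pow_mul, mul_comm]
    · rw [hi', h₁, one_pow, one_pow]
    · have hi2 : 2 ≤ (i : ℕ) := by
        simp only [hi₀, hi₁, Fin.ext_iff] at hi hi'
        omega
      rw [← pow_mul, Nat.div_mul_cancel (hrest i hi2)]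
end

section
/- Let p_1, p_2, p_3, p_4 be distinct complex numbers. Then there exist entire functions g_0, g_1, h : ℂ → ℂ such that g_0 and g_1 have no common zero, g_0 and g_1 are linearly independent over ℂ, and h(z)² = ∏_{i=1}^{4} (g_0(z) − p_i g_1(z)) for all z ∈ ℂ. -/
open Filter Topology Asymptotics

/-- The iterates `Φ^[n] (γ (z / 2 ^ n))`, for an approximate solution `γ` of the equation
`u (2 * z) = Φ (u z)`, converge geometrically near `0`. -/
theorem exists_ball_geometric_iterates {E : Type*} [NormedAddCommGroup E] [NormedSpace ℂ E]
    {Φ : E → E} {L : NNReal} (hL : L < 8) {t : Set E} {γ : ℂ → E} (ht : t ∈ 𝓝 (γ 0))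
    (hLip : LipschitzOnWith L Φ t) (hγ : ∀ᶠ z in 𝓝 0, DifferentiableAt ℂ γ z)
    (hO : (fun z => Φ (γ (z / 2)) - γ z) =O[𝓝 0] fun z : ℂ => z ^ 3) :
    ∃ ρ > 0, ∃ C > 0, (∀ z : ℂ, ‖z‖ < ρ → DifferentiableAt ℂ γ z) ∧
      ∀ n : ℕ, ∀ z : ℂ, ‖z‖ < ρ →
        dist (Φ^[n] (γ (z / 2 ^ n))) (Φ^[n + 1] (γ (z / 2 ^ (n + 1)))) ≤
          C * ‖z‖ ^ 3 * ((L : ℝ) / 8) ^ n := by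
  obtain ⟨r, hr, hrt⟩ := Metric.mem_nhds_iff.1 ht
  obtain ⟨C, hC, hOC⟩ := hO.exists_pos
  set q : ℝ := (L : ℝ) / 8 with hq
  have hL' : (L : ℝ) < 8 := by exact_mod_cast hL
  have hq0 : 0 ≤ q := by positivity
  have hq1 : q < 1 := by rw [hq]; linarith
  have hq1' : 0 < 1 - q := by linarith
  have hcont : ContinuousAt γ 0 := hγ.self_of_nhds.continuousAt
  have hsmall : ∀ᶠ z : ℂ in 𝓝 0, C * ‖z‖ ^ 3 * (1 - q)⁻¹ < r / 2 := by
    have : ContinuousAt (fun z : ℂ => C * ‖z‖ ^ 3 * (1 - q)⁻¹) 0 := by fun_prop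
    exact this.eventually_lt_const (by simpa using hr)
  have hclose : ∀ᶠ z : ℂ in 𝓝 0, dist (γ z) (γ 0) < r / 2 :=
    hcont.eventually (Metric.ball_mem_nhds _ (half_pos hr))
  obtain ⟨ρ, hρ, hall⟩ := Metric.eventually_nhds_iff.1
    ((hγ.and hOC.bound).and (hsmall.and hclose))
  simp only [dist_zero_right] at hall
  have half_lt : ∀ z : ℂ, ‖z‖ < ρ → ‖z / 2‖ < ρ := fun z hz => by
    rw [norm_div, Complex.norm_ofNat]; linarith [norm_nonneg z]
  refine ⟨ρ, hρ, C, hC, fun z hz => (hall hz).1.1, ?_⟩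
  have hstep : ∀ n : ℕ, ∀ z : ℂ, Φ^[n + 1] (γ (z / 2 ^ (n + 1))) =
      Φ (Φ^[n] (γ (z / 2 / 2 ^ n))) := fun n z => by
    rw [Function.iterate_succ_apply', div_div, pow_succ']
  have hgeom : ∀ n : ℕ, ∑ i ∈ Finset.range n, q ^ i ≤ (1 - q)⁻¹ := fun n => by
    rw [← tsum_geometric_of_lt_one hq0 hq1]
    exact (summable_geometric_of_lt_one hq0 hq1).sum_le_tsum _ fun i _ => by positivity
  have key : ∀ n : ℕ, ∀ z : ℂ, ‖z‖ < ρ →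
      dist (Φ^[n] (γ (z / 2 ^ n))) (γ z) ≤ C * ‖z‖ ^ 3 * ∑ i ∈ Finset.range n, q ^ i ∧
      dist (Φ^[n] (γ (z / 2 ^ n))) (Φ^[n + 1] (γ (z / 2 ^ (n + 1)))) ≤
        C * ‖z‖ ^ 3 * q ^ n := by
    intro n
    induction n with
    | zero =>
      intro z hz
      have := (hall hz).1.2
      simpa [dist_eq_norm, norm_sub_rev (γ z)] using this
    | succ n ih =>
      have hsum : ∀ z : ℂ, ‖z‖ < ρ → dist (Φ^[n + 1] (γ (z / 2 ^ (n + 1)))) (γ z) ≤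
          C * ‖z‖ ^ 3 * ∑ i ∈ Finset.range (n + 1), q ^ i := fun z hz => by
        obtain ⟨h1, h2⟩ := ih z hz
        rw [dist_comm] at h2
        rw [Finset.sum_range_succ, mul_add]
        linarith [dist_triangle (Φ^[n + 1] (γ (z / 2 ^ (n + 1)))) (Φ^[n] (γ (z / 2 ^ n))) (γ z)]
      have hmem : ∀ k z, ‖z‖ < ρ → dist (Φ^[k] (γ (z / 2 ^ k))) (γ z) ≤
          C * ‖z‖ ^ 3 * ∑ i ∈ Finset.range k, q ^ i → Φ^[k] (γ (z / 2 ^ k)) ∈ t := by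
        intro k z hz h
        refine hrt (Metric.mem_ball.2 ?_)
        have h1 : C * ‖z‖ ^ 3 * ∑ i ∈ Finset.range k, q ^ i ≤ C * ‖z‖ ^ 3 * (1 - q)⁻¹ := by
          gcongr; exact hgeom k
        linarith [(hall hz).2.1, (hall hz).2.2,
          dist_triangle (Φ^[k] (γ (z / 2 ^ k))) (γ z) (γ 0)]
      intro z hz
      refine ⟨hsum z hz, ?_⟩
      have hz2 := half_lt z hz
      rw [hstep n, hstep (n + 1)]
      calc _ ≤ L * dist (Φ^[n] (γ (z / 2 / 2 ^ n))) (Φ^[n + 1] (γ (z / 2 / 2 ^ (n + 1)))) :=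
            hLip.dist_le_mul _ (hmem _ _ hz2 (ih _ hz2).1) _ (hmem _ _ hz2 (hsum _ hz2))
        _ ≤ L * (C * ‖z / 2‖ ^ 3 * q ^ n) := by gcongr; exact (ih _ hz2).2
        _ = C * ‖z‖ ^ 3 * q ^ (n + 1) := by
            rw [norm_div, Complex.norm_ofNat, pow_succ q, hq]; ring
  exact fun n z hz => (key n z hz).2

/-- An approximate solution `γ`, up to order `3` at `0`, of the functional equation
`u (2 * z) = Φ (u z)` gives rise to an entire solution with the same `2`-jet at `0`. -/
theorem exists_entire_semiconj {E : Type*} [NormedAddCommGroup E] [NormedSpace ℂ E]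
    [CompleteSpace E] {Φ : E → E} (hΦ : Differentiable ℂ Φ) {L : NNReal} (hL : L < 8) {t : Set E}
    {γ : ℂ → E} (ht : t ∈ 𝓝 (γ 0)) (hLip : LipschitzOnWith L Φ t)
    (hγ : ∀ᶠ z in 𝓝 0, DifferentiableAt ℂ γ z)
    (hO : (fun z => Φ (γ (z / 2)) - γ z) =O[𝓝 0] fun z : ℂ => z ^ 3) :
    ∃ U : ℂ → E, Differentiable ℂ U ∧ (∀ z, U (2 * z) = Φ (U z)) ∧
      ((fun z => U z - γ z) =O[𝓝 0] fun z : ℂ => z ^ 3) ∧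
      ∀ z, Tendsto (fun n => Φ^[n] (γ (z / 2 ^ n))) atTop (𝓝 (U z)) := by
  obtain ⟨ρ, hρ, C, hC, hdiff, hgeo⟩ := exists_ball_geometric_iterates hL ht hLip hγ hO
  set q : ℝ := (L : ℝ) / 8 with hq
  have hL' : (L : ℝ) < 8 := by exact_mod_cast hL
  have hq0 : 0 ≤ q := by positivity
  have hq1 : q < 1 := by rw [hq]; linarith
  have hq1' : 0 < 1 - q := by linarith
  have hshrink : ∀ z : ℂ, ∀ᶠ m : ℕ in atTop, ‖z / 2 ^ m‖ < ρ := fun z => by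
    have h : Tendsto (fun m : ℕ => ‖z‖ * (1 / 2 : ℝ) ^ m) atTop (𝓝 (‖z‖ * 0)) :=
      (tendsto_pow_atTop_nhds_zero_of_lt_one (by norm_num) (by norm_num)).const_mul _
    rw [mul_zero] at h
    filter_upwards [h.eventually_lt_const hρ] with m hm
    rwa [norm_div, norm_pow, Complex.norm_ofNat, div_eq_mul_inv, ← inv_pow, ← one_div]
  have hiter : ∀ (m n : ℕ) (z : ℂ), Φ^[n + m] (γ (z / 2 ^ (n + m))) =
      Φ^[m] (Φ^[n] (γ (z / 2 ^ m / 2 ^ n))) := fun m n z => by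
    rw [← Function.iterate_add_apply, div_div, ← pow_add, add_comm]
  have hlim : ∀ z : ℂ, ∃ u, Tendsto (fun n => Φ^[n] (γ (z / 2 ^ n))) atTop (𝓝 u) := by
    intro z
    obtain ⟨m, hm⟩ := (hshrink z).exists
    obtain ⟨v, hv⟩ := cauchySeq_tendsto_of_complete
      (cauchySeq_of_le_geometric q _ hq1 fun n => hgeo n _ hm)
    refine ⟨Φ^[m] v, (tendsto_add_atTop_iff_nat m).1 ?_⟩
    simp only [hiter]
    exact ((hΦ.continuous.iterate m).tendsto v).comp hv
  choose U hU using hlim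
  have hUm : ∀ (m : ℕ) (z : ℂ), U z = Φ^[m] (U (z / 2 ^ m)) := fun m z => by
    refine tendsto_nhds_unique ((tendsto_add_atTop_iff_nat m).2 (hU z)) ?_
    simp only [hiter]
    exact ((hΦ.continuous.iterate m).tendsto _).comp (hU _)
  have hdist : ∀ (n : ℕ) (z : ℂ), ‖z‖ < ρ →
      dist (Φ^[n] (γ (z / 2 ^ n))) (U z) ≤ C * ‖z‖ ^ 3 * q ^ n / (1 - q) := fun n z hz =>
    dist_le_of_le_geometric_of_tendsto q _ hq1 (fun n => hgeo n z hz) (hU z) n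
  have hball : DifferentiableOn ℂ U (Metric.ball 0 ρ) := by
    refine TendstoLocallyUniformlyOn.differentiableOn (φ := atTop)
      (F := fun n z => Φ^[n] (γ (z / 2 ^ n)))
      (TendstoUniformlyOn.tendstoLocallyUniformlyOn ?_) (.of_forall fun n => ?_) Metric.isOpen_ball
    · rw [Metric.tendstoUniformlyOn_iff]
      intro ε hε
      have h : Tendsto (fun n : ℕ => C * ρ ^ 3 * q ^ n / (1 - q)) atTop
          (𝓝 (C * ρ ^ 3 * 0 / (1 - q))) :=
        ((tendsto_pow_atTop_nhds_zero_of_lt_one hq0 hq1).const_mul _).div_const _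
      rw [mul_zero, zero_div] at h
      filter_upwards [h.eventually_lt_const hε] with n hn z hz
      rw [mem_ball_zero_iff] at hz
      rw [dist_comm]
      refine (hdist n z hz).trans_lt (lt_of_le_of_lt ?_ hn)
      gcongr
    · intro z hz
      rw [mem_ball_zero_iff] at hz
      have h2 : ‖z / 2 ^ n‖ < ρ := by
        refine lt_of_le_of_lt ?_ hz
        rw [norm_div, norm_pow, Complex.norm_ofNat]
        exact div_le_self (norm_nonneg z) (one_le_pow₀ (by norm_num))
      have h3 : DifferentiableAt ℂ (fun z : ℂ => γ (z / 2 ^ n)) z :=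
        (hdiff _ h2).fun_comp' z (differentiableAt_id.div_const _)
      exact ((hΦ.iterate n).differentiableAt.fun_comp' z h3).differentiableWithinAt
  refine ⟨U, fun z => ?_, fun z => ?_, ?_, hU⟩
  · obtain ⟨m, hm⟩ := (hshrink z).exists
    have h1 : DifferentiableAt ℂ U (z / 2 ^ m) :=
      hball.differentiableAt (Metric.isOpen_ball.mem_nhds (mem_ball_zero_iff.2 hm))
    have h2 : DifferentiableAt ℂ (fun z : ℂ => U (z / 2 ^ m)) z :=
      h1.fun_comp' z (differentiableAt_id.div_const _)
    rw [show U = fun z => Φ^[m] (U (z / 2 ^ m)) from funext (hUm m)]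
    exact (hΦ.iterate m).differentiableAt.fun_comp' z h2
  · simpa using hUm 1 (2 * z)
  · refine IsBigO.of_bound (C / (1 - q)) ?_
    filter_upwards [Metric.ball_mem_nhds (0 : ℂ) hρ] with z hz
    have := hdist 0 z (mem_ball_zero_iff.1 hz)
    rw [dist_comm, dist_eq_norm] at this
    simp only [Function.iterate_zero, id, pow_zero, div_one, mul_one] at this
    rw [norm_pow]
    linarith [show C * ‖z‖ ^ 3 / (1 - q) = C / (1 - q) * ‖z‖ ^ 3 by ring]

/-- The duplication map `(sn, cn, dn, 1)(z) ↦ (sn, cn, dn, 1)(2 * z)` of the Jacobi elliptic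
functions of parameter `m`, in homogeneous coordinates. -/
def jacobiDuplication (m : ℂ) (u : Fin 4 → ℂ) : Fin 4 → ℂ :=
  ![2 * u 0 * u 1 * u 2 * u 3, u 1 ^ 2 * u 3 ^ 2 - u 0 ^ 2 * u 2 ^ 2,
    u 2 ^ 2 * u 3 ^ 2 - m * u 0 ^ 2 * u 1 ^ 2, u 3 ^ 4 - m * u 0 ^ 4]

/-- The affine cone over the Jacobi intersection `s² + c² = n²`, `m s² + d² = n²`. -/
def jacobiCone (m : ℂ) : Set (Fin 4 → ℂ) :=
  {u | u 0 ^ 2 + u 1 ^ 2 = u 3 ^ 2 ∧ m * u 0 ^ 2 + u 2 ^ 2 = u 3 ^ 2}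

theorem isClosed_jacobiCone (m : ℂ) : IsClosed (jacobiCone m) :=
  (isClosed_eq (by fun_prop) (by fun_prop)).inter (isClosed_eq (by fun_prop) (by fun_prop))

theorem mapsTo_jacobiDuplication (m : ℂ) :
    Set.MapsTo (jacobiDuplication m) (jacobiCone m) (jacobiCone m) := by
  rintro u ⟨h1, h2⟩
  have hc : u 1 ^ 2 = u 3 ^ 2 - u 0 ^ 2 := by linear_combination h1
  have hd : u 2 ^ 2 = u 3 ^ 2 - m * u 0 ^ 2 := by linear_combination h2
  constructor
  · simp only [jacobiDuplication, Matrix.cons_val, mul_pow, hc, hd]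
    ring
  · simp only [jacobiDuplication, Matrix.cons_val, mul_pow, hc, hd]
    ring

theorem differentiable_jacobiDuplication (m : ℂ) : Differentiable ℂ (jacobiDuplication m) := by
  rw [differentiable_pi]
  intro i
  fin_cases i <;> simp only [jacobiDuplication, Matrix.cons_val, Fin.zero_eta, Fin.mk_one,
    Fin.reduceFinMk] <;> fun_prop

theorem jacobiDuplication_ne_zero {m : ℂ} (hm0 : m ≠ 0) (hm1 : m ≠ 1) {u : Fin 4 → ℂ}
    (hu : u ∈ jacobiCone m) (h : u 0 ≠ 0 ∨ u 3 ≠ 0) :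
    jacobiDuplication m u 0 ≠ 0 ∨ jacobiDuplication m u 3 ≠ 0 := by
  by_contra! hcon
  obtain ⟨h1, h2⟩ := hu
  obtain ⟨hS, hN⟩ := hcon
  simp only [jacobiDuplication, Matrix.cons_val] at hS hN
  have hm1' : 1 - m ≠ 0 := sub_ne_zero.2 hm1.symm
  have h03 : u 0 = 0 ↔ u 3 = 0 := by
    constructor
    · intro h0
      simpa [h0] using hN
    · intro h3
      simpa [h3, hm0] using hN
  have h0 : u 0 ≠ 0 := by tauto
  have h3 : u 3 ≠ 0 := by tauto
  simp only [mul_eq_zero, OfNat.ofNat_ne_zero, h0, h3, false_or, or_false] at hS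
  rcases hS with hc | hd
  · rw [hc] at h1
    have : u 0 ^ 4 * (1 - m) = 0 := by
      linear_combination hN + (u 0 ^ 2 + u 3 ^ 2) * h1
    simp_all
  · rw [hd] at h2
    have : u 0 ^ 4 * (m * (1 - m)) = 0 := by
      linear_combination (-1) * hN - (m * u 0 ^ 2 + u 3 ^ 2) * h2
    simp_all

theorem hasStrictFDerivAt_jacobiDuplication (m : ℂ) :
    HasStrictFDerivAt (jacobiDuplication m)
      (ContinuousLinearMap.pi (R := ℂ) (φ := fun _ : Fin 4 => ℂ) ![(2 : ℂ) • ContinuousLinearMap.proj 0,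
        (2 : ℂ) • ContinuousLinearMap.proj 1 + (2 : ℂ) • ContinuousLinearMap.proj 3,
        (2 : ℂ) • ContinuousLinearMap.proj 2 + (2 : ℂ) • ContinuousLinearMap.proj 3, (4 : ℂ) • ContinuousLinearMap.proj 3])
      (![0, 1, 1, 1] : Fin 4 → ℂ) := by
  have hp : ∀ i : Fin 4, HasStrictFDerivAt (𝕜 := ℂ) (fun u : Fin 4 → ℂ => u i)
      (.proj i) (![0, 1, 1, 1] : Fin 4 → ℂ) := fun i =>
    hasStrictFDerivAt_apply i _
  refine hasStrictFDerivAt_pi'.2 fun i => ?_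
  fin_cases i
  · refine (((((hp 0).const_mul 2).mul (hp 1)).mul (hp 2)).mul (hp 3)).congr_fderiv ?_
    ext v
    simp
  · refine ((((hp 1).pow 2).mul ((hp 3).pow 2)).sub
      (((hp 0).pow 2).mul ((hp 2).pow 2))).congr_fderiv ?_
    ext v
    simp [add_comm]
  · refine ((((hp 2).pow 2).mul ((hp 3).pow 2)).sub
      ((((hp 0).pow 2).const_mul m).mul ((hp 1).pow 2))).congr_fderiv ?_
    ext v
    simp [add_comm]
  · refine (((hp 3).pow 4).sub (((hp 0).pow 4).const_mul m)).congr_fderiv ?_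
    ext v
    simp

theorem exists_lipschitzOnWith_jacobiDuplication (m : ℂ) :
    ∃ t ∈ 𝓝 (![0, 1, 1, 1] : Fin 4 → ℂ), LipschitzOnWith 5 (jacobiDuplication m) t := by
  refine (hasStrictFDerivAt_jacobiDuplication m).exists_lipschitzOnWith_of_nnnorm_lt 5 ?_
  rw [← NNReal.coe_lt_coe, coe_nnnorm]
  refine lt_of_le_of_lt (ContinuousLinearMap.opNorm_le_bound _ (M := 4) (by norm_num)
    fun v => ?_) (by norm_num)
  refine (pi_norm_le_iff_of_nonneg (by positivity)).2 fun i => ?_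
  have hv := norm_le_pi_norm v
  have h2 : ∀ w : ℂ, ‖2 * w‖ = 2 * ‖w‖ := fun w => by simp
  have h4 : ∀ w : ℂ, ‖4 * w‖ = 4 * ‖w‖ := fun w => by simp
  have h22 : ∀ i j, ‖2 * v i + 2 * v j‖ ≤ 4 * ‖v‖ := fun i j => by
    linarith [norm_add_le (2 * v i) (2 * v j), h2 (v i), h2 (v j), hv i, hv j]
  fin_cases i
  · simpa using by linarith [hv 0, norm_nonneg v]
  · simpa using h22 1 3
  · simpa using h22 2 3
  · simpa using hv 3

/-- A curve on the Jacobi intersection whose image under duplication agrees with its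
reparametrization by `z ↦ 2 * z` up to order `3` at `0`. -/
noncomputable def jacobiApprox (m z : ℂ) : Fin 4 → ℂ :=
  ![z, (1 - z ^ 2) ^ ((2 : ℕ) : ℂ)⁻¹, (1 - m * z ^ 2) ^ ((2 : ℕ) : ℂ)⁻¹, 1]

theorem jacobiApprox_zero (m : ℂ) : jacobiApprox m 0 = ![0, 1, 1, 1] := by
  simp [jacobiApprox]

theorem jacobiApprox_mem (m z : ℂ) : jacobiApprox m z ∈ jacobiCone m := by
  constructor
  · simp only [jacobiApprox, Matrix.cons_val, Complex.cpow_nat_inv_pow _ two_ne_zero]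
    ring
  · simp only [jacobiApprox, Matrix.cons_val, Complex.cpow_nat_inv_pow _ two_ne_zero]
    ring

theorem eventually_differentiableAt_sqrt (a : ℂ) :
    ∀ᶠ z : ℂ in 𝓝 0, DifferentiableAt ℂ (fun z => (1 - a * z ^ 2) ^ ((2 : ℕ) : ℂ)⁻¹) z := by
  have h : ContinuousAt (fun z : ℂ => 1 - a * z ^ 2) 0 := by fun_prop
  have h1 : (1 - a * 0 ^ 2 : ℂ) ∈ Complex.slitPlane := by simp
  filter_upwards [h.eventually (Complex.isOpen_slitPlane.mem_nhds h1)] with z hz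
  exact DifferentiableAt.cpow_const (by fun_prop) hz

theorem eventually_differentiableAt_jacobiApprox (m : ℂ) :
    ∀ᶠ z in 𝓝 0, DifferentiableAt ℂ (jacobiApprox m) z := by
  filter_upwards [eventually_differentiableAt_sqrt 1, eventually_differentiableAt_sqrt m]
    with z h1 hm
  simp only [one_mul] at h1
  rw [differentiableAt_pi]
  intro i
  fin_cases i <;> simp only [jacobiApprox, Matrix.cons_val, Fin.zero_eta, Fin.mk_one,
    Fin.reduceFinMk]
  · fun_prop
  · exact h1
  · exact hm
  · fun_prop

theorem isBigO_sqrt_sub_one (a : ℂ) :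
    (fun z : ℂ => (1 - a * z ^ 2) ^ ((2 : ℕ) : ℂ)⁻¹ - 1) =O[𝓝 0] fun z : ℂ => z ^ 2 := by
  have hd : DifferentiableAt ℂ (fun x : ℂ => (1 - a * x) ^ ((2 : ℕ) : ℂ)⁻¹) 0 :=
    DifferentiableAt.cpow_const (by fun_prop) (by simp)
  have ht : Tendsto (fun z : ℂ => z ^ 2) (𝓝 0) (𝓝 0) := by
    have : ContinuousAt (fun z : ℂ => z ^ 2) 0 := by fun_prop
    simpa [ContinuousAt] using this
  simpa [Function.comp_def] using hd.isBigO_sub.comp_tendsto ht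

theorem isBigO_sqrt_sub (a : ℂ) :
    (fun z : ℂ => 1 - a * z ^ 2 / 2 - (1 - a * z ^ 2) ^ ((2 : ℕ) : ℂ)⁻¹) =O[𝓝 0]
      fun z : ℂ => z ^ 4 := by
  have h := ((isBigO_sqrt_sub_one a).pow 2).const_mul_left (1 / 2)
  refine (h.congr (fun z => ?_) fun z => by ring)
  linear_combination (1 / 2 : ℂ) * Complex.cpow_nat_inv_pow (1 - a * z ^ 2) two_ne_zero

theorem isBigO_jacobiDuplication_approx (m : ℂ) :
    (fun z => jacobiDuplication m (jacobiApprox m (z / 2)) - jacobiApprox m z) =O[𝓝 0]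
      fun z : ℂ => z ^ 3 := by
  have h43 : (fun z : ℂ => z ^ 4) =O[𝓝 0] fun z : ℂ => z ^ 3 :=
    (isLittleO_pow_pow (by norm_num)).isBigO
  have hs : ∀ a : ℂ, (fun z : ℂ => (1 - a * (z / 2) ^ 2) ^ ((2 : ℕ) : ℂ)⁻¹ - 1) =O[𝓝 0]
      fun z : ℂ => z ^ 2 := fun a => by
    refine (isBigO_sqrt_sub_one (a / 4)).congr_left fun z => ?_
    ring_nf
  have hs1 : (fun z : ℂ => (1 - m * (z / 2) ^ 2) ^ ((2 : ℕ) : ℂ)⁻¹) =O[𝓝 0]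
      fun _ => (1 : ℂ) := by
    have hd : DifferentiableAt ℂ (fun z : ℂ => (1 - m * (z / 2) ^ 2) ^ ((2 : ℕ) : ℂ)⁻¹) 0 :=
      DifferentiableAt.cpow_const (by fun_prop) (by simp)
    exact hd.continuousAt.isBigO_one ℂ
  have hsq : ∀ w : ℂ, (w ^ ((2 : ℕ) : ℂ)⁻¹) ^ 2 = w :=
    fun w => Complex.cpow_nat_inv_pow _ two_ne_zero
  rw [isBigO_pi]
  intro i
  fin_cases i <;> simp only [Pi.sub_apply, jacobiDuplication, jacobiApprox, Matrix.cons_val,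
    Fin.zero_eta, Fin.mk_one, Fin.reduceFinMk, hsq]
  · have h1 : (fun z : ℂ => ((1 - 1 * (z / 2) ^ 2) ^ ((2 : ℕ) : ℂ)⁻¹ - 1) *
        (1 - m * (z / 2) ^ 2) ^ ((2 : ℕ) : ℂ)⁻¹) =O[𝓝 0] fun z : ℂ => z ^ 2 := by
      simpa using (hs 1).mul hs1
    refine ((isBigO_refl (fun z : ℂ => z) _).mul (h1.add (hs m))).congr (fun z => ?_) fun z => ?_
    · rw [one_mul]; ring
    · ring
  · refine (((isBigO_sqrt_sub 1).add ((isBigO_refl (fun z : ℂ => z ^ 4) (𝓝 0)).const_mul_left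
      (m / 16))).trans h43).congr_left fun z => ?_
    rw [one_mul]; ring
  · refine (((isBigO_sqrt_sub m).add ((isBigO_refl (fun z : ℂ => z ^ 4) (𝓝 0)).const_mul_left
      (m / 16))).trans h43).congr_left fun z => ?_
    ring
  · refine (((isBigO_refl (fun z : ℂ => z ^ 4) (𝓝 0)).const_mul_left
      (-m / 16)).trans h43).congr_left fun z => ?_
    ring

/-- A nonconstant entire curve on the Jacobi intersection of parameter `m ≠ 0, 1`. -/
theorem exists_entire_jacobiCone {m : ℂ} (hm0 : m ≠ 0) (hm1 : m ≠ 1) :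
    ∃ U : ℂ → Fin 4 → ℂ, Differentiable ℂ U ∧ (∀ z, U z ∈ jacobiCone m) ∧
      (∀ z, U z 0 ≠ 0 ∨ U z 3 ≠ 0) ∧ U 0 = ![0, 1, 1, 1] ∧ ∃ z, U z 0 ≠ 0 := by
  obtain ⟨t, ht, hLip⟩ := exists_lipschitzOnWith_jacobiDuplication m
  rw [← jacobiApprox_zero m] at ht
  obtain ⟨U, hU, hU2, hUO, hlim⟩ := exists_entire_semiconj (differentiable_jacobiDuplication m)
    (by norm_num) ht hLip (eventually_differentiableAt_jacobiApprox m)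
    (isBigO_jacobiDuplication_approx m)
  have hmem : ∀ z, U z ∈ jacobiCone m := fun z =>
    (isClosed_jacobiCone m).mem_of_tendsto (hlim z) <| .of_forall fun n =>
      (mapsTo_jacobiDuplication m).iterate n (jacobiApprox_mem m _)
  have hU0 : U 0 = ![0, 1, 1, 1] := by
    obtain ⟨C, hC⟩ := hUO.bound
    have h0 := hC.self_of_nhds
    rw [zero_pow three_ne_zero, norm_zero, mul_zero, norm_le_zero_iff, sub_eq_zero] at h0
    rw [h0, jacobiApprox_zero]
  refine ⟨U, hU, hmem, fun z => ?_, hU0, ?_⟩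
  · have hz : Tendsto (fun k : ℕ => z * (1 / 2 : ℂ) ^ k) atTop (𝓝 (z * 0)) :=
      (tendsto_pow_atTop_nhds_zero_of_norm_lt_one (by norm_num)).const_mul z
    rw [mul_zero] at hz
    have hcont : ContinuousAt (fun z => U z 3) 0 :=
      ((continuous_apply 3).comp hU.continuous).continuousAt
    obtain ⟨k, hk⟩ := (hz.eventually (hcont.eventually_ne (by simp [hU0] : U 0 3 ≠ 0))).exists
    have hdouble : ∀ (j : ℕ) (w : ℂ), (U w 0 ≠ 0 ∨ U w 3 ≠ 0) →
        (U (2 ^ j * w) 0 ≠ 0 ∨ U (2 ^ j * w) 3 ≠ 0) := by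
      intro j w hw
      induction j with
      | zero => simpa using hw
      | succ j ih =>
        rw [pow_succ', mul_assoc, hU2]
        exact jacobiDuplication_ne_zero hm0 hm1 (hmem _) ih
    have := hdouble k _ (Or.inr hk)
    rwa [mul_left_comm, ← mul_pow, mul_one_div_cancel two_ne_zero, one_pow, mul_one] at this
  · by_contra! h
    have h1 : (fun z : ℂ => z) =O[𝓝 0] fun z : ℂ => z ^ 3 := by
      simpa [h, jacobiApprox] using (isBigO_pi.1 hUO 0).neg_left
    have h2 : (fun z : ℂ => z ^ 3) =o[𝓝 0] fun z : ℂ => z := by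
      simpa using isLittleO_pow_pow (𝕜 := ℂ) (show 1 < 3 by norm_num)
    refine isLittleO_irrefl ?_ (h1.trans_isLittleO h2)
    exact (eventually_mem_nhdsWithin (a := (0 : ℂ)) (s := {0}ᶜ)).frequently.filter_mono
      nhdsWithin_le_nhds

/-- The double cover of ℙ¹ branched at four distinct points is an elliptic
curve, hence not Brody hyperbolic: there exist entire functions `g₀, g₁, h`
with `g₀, g₁` having no common zero, linearly independent over ℂ, and
`h² = ∏ᵢ (g₀ - pᵢ g₁)`. -/
theorem double_cover_P1_four_points_not_hyperbolic
    (p : Fin 4 → ℂ) (hp : Function.Injective p) :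
    ∃ g₀ g₁ h : ℂ → ℂ,
      Differentiable ℂ g₀ ∧ Differentiable ℂ g₁ ∧ Differentiable ℂ h ∧
      (∀ z : ℂ, g₀ z ≠ 0 ∨ g₁ z ≠ 0) ∧
      (¬ ∃ c₀ c₁ : ℂ, (c₀ ≠ 0 ∨ c₁ ≠ 0) ∧ ∀ z : ℂ, c₁ * g₀ z = c₀ * g₁ z) ∧
      ∀ z : ℂ, h z ^ 2 = ∏ i, (g₀ z - p i * g₁ z) := by
  have hsub : ∀ i j : Fin 4, i ≠ j → p i - p j ≠ 0 := fun i j hij =>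
    sub_ne_zero.2 (hp.ne hij)
  have h10 := hsub 1 0 (by decide)
  have h20 := hsub 2 0 (by decide)
  have h30 := hsub 3 0 (by decide)
  have h21 := hsub 2 1 (by decide)
  have h31 := hsub 3 1 (by decide)
  have h32 := hsub 3 2 (by decide)
  obtain ⟨m, hm⟩ : ∃ m : ℂ, m * ((p 2 - p 1) * (p 3 - p 0)) = (p 2 - p 0) * (p 3 - p 1) :=
    ⟨_, div_mul_cancel₀ _ (mul_ne_zero h21 h30)⟩
  have hm0 : m ≠ 0 := by
    rintro rfl
    rw [zero_mul] at hm
    exact mul_ne_zero h20 h31 hm.symm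
  have hm1 : m ≠ 1 := by
    rintro rfl
    exact mul_ne_zero h32 h10 (by linear_combination (-1) * hm)
  obtain ⟨U, hU, hmem, hne, hU0, z₁, hz₁⟩ := exists_entire_jacobiCone hm0 hm1
  have hUi : ∀ i, Differentiable ℂ fun z => U z i := fun i => differentiable_pi.1 hU i
  have d0 := hUi 0
  have d1 := hUi 1
  have d2 := hUi 2
  have d3 := hUi 3
  obtain ⟨κ, hκ⟩ : ∃ κ : ℂ, κ ^ 2 = (p 2 - p 0) * (p 1 - p 0) * ((p 2 - p 1) * (p 1 - p 0)) *
      ((p 2 - p 1) * (p 2 - p 0)) * ((p 2 - p 1) * (p 3 - p 0)) :=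
    ⟨_, Complex.cpow_nat_inv_pow _ two_ne_zero⟩
  set g₁ : ℂ → ℂ := fun z => (p 2 - p 0) * U z 0 ^ 2 - (p 2 - p 1) * U z 3 ^ 2 with hg₁
  set g₀ : ℂ → ℂ := fun z => p 0 * g₁ z + (p 1 - p 0) * (p 2 - p 0) * U z 0 ^ 2 with hg₀
  have e0 : ∀ z, g₀ z - p 0 * g₁ z = (p 2 - p 0) * (p 1 - p 0) * U z 0 ^ 2 := fun z => by
    simp only [hg₀]; ring
  have e1 : ∀ z, g₀ z - p 1 * g₁ z = (p 2 - p 1) * (p 1 - p 0) * U z 3 ^ 2 := fun z => by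
    simp only [hg₀, hg₁]; ring
  have e2 : ∀ z, g₀ z - p 2 * g₁ z = (p 2 - p 1) * (p 2 - p 0) * U z 1 ^ 2 := fun z => by
    simp only [hg₀, hg₁]
    linear_combination (-(p 2 - p 1) * (p 2 - p 0)) * (hmem z).1
  have e3 : ∀ z, g₀ z - p 3 * g₁ z = (p 2 - p 1) * (p 3 - p 0) * U z 2 ^ 2 := fun z => by
    simp only [hg₀, hg₁]
    linear_combination (-(p 2 - p 1) * (p 3 - p 0)) * (hmem z).2 + U z 0 ^ 2 * hm
  refine ⟨g₀, g₁, fun z => κ * (U z 0 * U z 1 * U z 2 * U z 3), by fun_prop, by fun_prop,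
    by fun_prop, fun z => ?_, ?_, fun z => ?_⟩
  · by_contra! hz
    have h0 := e0 z
    have h1 := e1 z
    simp only [hz.1, hz.2, mul_zero, sub_zero] at h0 h1
    replace h0 := eq_zero_of_ne_zero_of_mul_left_eq_zero (mul_ne_zero h20 h10) h0.symm
    replace h1 := eq_zero_of_ne_zero_of_mul_left_eq_zero (mul_ne_zero h21 h10) h1.symm
    exact (hne z).elim (· (pow_eq_zero_iff two_ne_zero |>.1 h0))
      (· (pow_eq_zero_iff two_ne_zero |>.1 h1))
  · rintro ⟨c₀, c₁, hc, hlin⟩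
    have hg10 : g₁ 0 ≠ 0 := by simpa [hg₁, hU0] using hsub 1 2 (by decide)
    have hg00 : g₀ 0 = p 0 * g₁ 0 := by simp [hg₀, hU0]
    have hc0 : c₀ = c₁ * p 0 := by
      refine mul_right_cancel₀ hg10 ?_
      linear_combination c₁ * hg00 - hlin 0
    have hc1 : c₁ ≠ 0 := by
      rintro rfl
      simp [hc0] at hc
    have h : c₁ * ((p 2 - p 0) * (p 1 - p 0) * U z₁ 0 ^ 2) = 0 := by
      rw [← e0]
      linear_combination hlin z₁ + g₁ z₁ * hc0
    exact mul_ne_zero hc1 (mul_ne_zero (mul_ne_zero h20 h10) (pow_ne_zero 2 hz₁)) h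
  · rw [Fin.prod_univ_four, e0, e1, e2, e3, mul_pow, hκ]
    ring
end
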